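/- (Theorem A) Let Z be a set of s ≥ 9 points in the complex projective plane ℙ² and let I be its radical homogeneous ideal. If α̂(I) < 5/2, then either Z is contained in a conic (and consequently α̂(I) ≤ 2), or s = 9 and the nine points form the following configuration, in which case α̂(I) = 17/7: there is a line ℓ containing exactly six of the points, among them three points Q₁, Q₂, C; a point P not on ℓ; a point A on the line PQ₁ with A ∉ {P, Q₁} and A ∉ ℓ; a point B on the line PQ₂ with B ∉ {P, Q₂} and B ∉ ℓ; the points A, B, C are collinear; and the only triples of collinear points among the nine are those contained in ℓ, in the line through P, Q₁, A, in the line through P, Q₂, B, and in the line through A, B, C. -/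

import Mathlib

open scoped LinearAlgebra.Projectivization

/-- A polynomial `F` vanishes to order at least `m` at the (affine representative) point
`v`: all iterated partial derivatives of order `≤ m - 1` (i.e. of order `< m`) vanish at `v`. -/
def VanishesToOrder (m : ℕ) (F : MvPolynomial (Fin 3) ℂ) (v : Fin 3 → ℂ) : Prop :=
  ∀ k : ℕ, k < m → ∀ d : Fin k → Fin 3,
    MvPolynomial.eval v ((List.ofFn d).foldl (fun p i => MvPolynomial.pderiv i p) F) = 0

/-- The `m`-th symbolic power of the (radical) ideal of a set `Z` of points of `ℙ²`:
all polynomials vanishing to order at least `m` at every point of `Z`. -/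
def symbolicPower (Z : Set (ℙ ℂ (Fin 3 → ℂ))) (m : ℕ) : Set (MvPolynomial (Fin 3) ℂ) :=
  {F | ∀ P ∈ Z, ∀ (v : Fin 3 → ℂ) (hv : v ≠ 0),
    Projectivization.mk ℂ v hv = P → VanishesToOrder m F v}

/-- The initial degree `α` of a set of polynomials: the least `t` such that the set contains
a nonzero homogeneous polynomial of degree `t`. -/
noncomputable def initialDegree (S : Set (MvPolynomial (Fin 3) ℂ)) : ℕ :=
  sInf {t | ∃ F ∈ S, F ≠ 0 ∧ F.IsHomogeneous t}

/-- The Waldschmidt constant `α̂(I) = inf_{m ≥ 1} α(I^(m))/m` of the radical ideal of `Z`. -/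
noncomputable def waldschmidt (Z : Set (ℙ ℂ (Fin 3 → ℂ))) : ℝ :=
  ⨅ m : ℕ+, (initialDegree (symbolicPower Z (m : ℕ)) : ℝ) / ((m : ℕ) : ℝ)

/-- A (homogeneous equation of a) line in `ℙ²`: a nonzero homogeneous polynomial of degree 1. -/
def IsLine (L : MvPolynomial (Fin 3) ℂ) : Prop := L ≠ 0 ∧ L.IsHomogeneous 1

/-- The point `x ∈ ℙ²` lies on the line (or curve) with equation `L`. -/
def MemLine (L : MvPolynomial (Fin 3) ℂ) (x : ℙ ℂ (Fin 3 → ℂ)) : Prop :=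
  ∀ (v : Fin 3 → ℂ) (hv : v ≠ 0), Projectivization.mk ℂ v hv = x → MvPolynomial.eval v L = 0

/-- Three points of `ℙ²` are collinear if some line contains all of them. -/
def Collin (x y z : ℙ ℂ (Fin 3 → ℂ)) : Prop :=
  ∃ M, IsLine M ∧ MemLine M x ∧ MemLine M y ∧ MemLine M z

/-- `Z` is contained in a conic: the zero set of a nonzero homogeneous polynomial of degree 2
(possibly degenerate). -/
def ContainedInConic (Z : Set (ℙ ℂ (Fin 3 → ℂ))) : Prop :=
  ∃ F : MvPolynomial (Fin 3) ℂ, F ≠ 0 ∧ F.IsHomogeneous 2 ∧ ∀ x ∈ Z, MemLine F x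

/-- The configuration of points consisting of: a line `L` containing exactly `t` points of `Z`,
among them three points `Q₁, Q₂, C`; a point `P ∈ Z` not on `L`; a point `A ∈ Z` on the line
`L₁` through `P` and `Q₁`, with `A ∉ {P, Q₁}` and `A` off `L`; a point `B ∈ Z` on the line `L₂`
through `P` and `Q₂`, with `B ∉ {P, Q₂}` and `B` off `L`; the points `A, B, C` collinear (on a
line `L₃`); and the only triples of collinear points of `Z` are those contained in one of the
lines `L`, `L₁`, `L₂`, `L₃`. -/
def StandardConfig (t : ℕ) (Z : Set (ℙ ℂ (Fin 3 → ℂ))) : Prop :=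
  ∃ L L₁ L₂ L₃ : MvPolynomial (Fin 3) ℂ, ∃ Q₁ Q₂ C P A B : ℙ ℂ (Fin 3 → ℂ),
    IsLine L ∧ IsLine L₁ ∧ IsLine L₂ ∧ IsLine L₃ ∧
    Q₁ ∈ Z ∧ Q₂ ∈ Z ∧ C ∈ Z ∧ P ∈ Z ∧ A ∈ Z ∧ B ∈ Z ∧
    Q₁ ≠ Q₂ ∧ Q₁ ≠ C ∧ Q₂ ≠ C ∧
    MemLine L Q₁ ∧ MemLine L Q₂ ∧ MemLine L C ∧
    (Z ∩ {x | MemLine L x}).ncard = t ∧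
    ¬ MemLine L P ∧
    MemLine L₁ P ∧ MemLine L₁ Q₁ ∧ MemLine L₁ A ∧ A ≠ P ∧ A ≠ Q₁ ∧ ¬ MemLine L A ∧
    MemLine L₂ P ∧ MemLine L₂ Q₂ ∧ MemLine L₂ B ∧ B ≠ P ∧ B ≠ Q₂ ∧ ¬ MemLine L B ∧
    MemLine L₃ A ∧ MemLine L₃ B ∧ MemLine L₃ C ∧
    (∀ X Y W, X ∈ Z → Y ∈ Z → W ∈ Z → X ≠ Y → X ≠ W → Y ≠ W → Collin X Y W →
      ((MemLine L X ∧ MemLine L Y ∧ MemLine L W) ∨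
       (MemLine L₁ X ∧ MemLine L₁ Y ∧ MemLine L₁ W) ∨
       (MemLine L₂ X ∧ MemLine L₂ Y ∧ MemLine L₂ W) ∨
       (MemLine L₃ X ∧ MemLine L₃ Y ∧ MemLine L₃ W)))

open MvPolynomial

/-- The plane projective space. -/
abbrev Plane : Type := ℙ ℂ (Fin 3 → ℂ)

/-! ### Vanishing order -/

theorem vanishesToOrder_zero (F : MvPolynomial (Fin 3) ℂ) (v : Fin 3 → ℂ) :
    VanishesToOrder 0 F v := fun k hk => absurd hk (Nat.not_lt_zero k)

theorem vanishesToOrder_succ {m : ℕ} {F : MvPolynomial (Fin 3) ℂ} {v : Fin 3 → ℂ} :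
    VanishesToOrder (m + 1) F v ↔ eval v F = 0 ∧ ∀ i, VanishesToOrder m (pderiv i F) v := by
  constructor
  · intro h
    refine ⟨by simpa using h 0 (Nat.succ_pos m) Fin.elim0, fun i k hk d => ?_⟩
    simpa [List.ofFn_succ] using h (k + 1) (Nat.succ_lt_succ hk) (Fin.cons i d)
  · rintro ⟨h₀, h⟩ k hk d
    cases k with
    | zero => simpa using h₀
    | succ k =>
      simpa [List.ofFn_succ] using h (d 0) k (Nat.lt_of_succ_lt_succ hk) (fun i => d i.succ)

theorem VanishesToOrder.of_succ {m : ℕ} {F : MvPolynomial (Fin 3) ℂ} {v : Fin 3 → ℂ}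
    (h : VanishesToOrder (m + 1) F v) : VanishesToOrder m F v :=
  fun k hk => h k (Nat.lt_succ_of_lt hk)

theorem VanishesToOrder.mono {m n : ℕ} {F : MvPolynomial (Fin 3) ℂ} {v : Fin 3 → ℂ}
    (h : VanishesToOrder n F v) (hmn : m ≤ n) : VanishesToOrder m F v :=
  fun k hk => h k (lt_of_lt_of_le hk hmn)

theorem VanishesToOrder.add {m : ℕ} {F G : MvPolynomial (Fin 3) ℂ} {v : Fin 3 → ℂ}
    (hF : VanishesToOrder m F v) (hG : VanishesToOrder m G v) : VanishesToOrder m (F + G) v := by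
  induction m generalizing F G with
  | zero => exact vanishesToOrder_zero _ _
  | succ m ih =>
    rw [vanishesToOrder_succ] at *
    refine ⟨by simp [hF.1, hG.1], fun i => ?_⟩
    rw [map_add]
    exact ih (hF.2 i) (hG.2 i)

theorem VanishesToOrder.mul {a b : ℕ} {F G : MvPolynomial (Fin 3) ℂ} {v : Fin 3 → ℂ}
    (hF : VanishesToOrder a F v) (hG : VanishesToOrder b G v) :
    VanishesToOrder (a + b) (F * G) v := by
  induction hn : a + b generalizing a b F G with
  | zero => exact vanishesToOrder_zero _ _
  | succ n ih =>
    rw [vanishesToOrder_succ]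
    constructor
    · rcases a with _ | a
      · rcases b with _ | b
        · omega
        · simp [(vanishesToOrder_succ.1 hG).1]
      · simp [(vanishesToOrder_succ.1 hF).1]
    · intro i
      rw [Derivation.leibniz, smul_eq_mul, smul_eq_mul]
      refine VanishesToOrder.add ?_ ?_
      · rcases b with _ | b
        · obtain ⟨a, rfl⟩ : ∃ a', a = a' + 1 := ⟨a - 1, by omega⟩
          exact ih hF.of_succ (vanishesToOrder_zero _ _) (by omega)
        · exact ih hF ((vanishesToOrder_succ.1 hG).2 i) (by omega)
      · rcases a with _ | a
        · obtain ⟨b, rfl⟩ : ∃ b', b = b' + 1 := ⟨b - 1, by omega⟩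
          exact ih hG.of_succ (vanishesToOrder_zero _ _) (by omega)
        · exact ih hG ((vanishesToOrder_succ.1 hF).2 i) (by omega)

theorem VanishesToOrder.pow {a : ℕ} {F : MvPolynomial (Fin 3) ℂ} {v : Fin 3 → ℂ}
    (hF : VanishesToOrder a F v) (k : ℕ) : VanishesToOrder (k * a) (F ^ k) v := by
  induction k with
  | zero => simpa using vanishesToOrder_zero _ _
  | succ k ih =>
    rw [pow_succ, Nat.succ_mul]
    exact ih.mul hF

/-- The Taylor expansion `F (v + t Y)` of `F` at `v`, as a polynomial in `t`. -/
noncomputable def taylorAt (v : Fin 3 → ℂ) :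
    MvPolynomial (Fin 3) ℂ →ₐ[ℂ] Polynomial (MvPolynomial (Fin 3) ℂ) :=
  aeval fun i => Polynomial.C (C (v i)) + Polynomial.X * Polynomial.C (X i)

theorem derivative_taylorAt (v : Fin 3 → ℂ) (F : MvPolynomial (Fin 3) ℂ) :
    Polynomial.derivative (taylorAt v F) =
      ∑ i, Polynomial.C (X i) * taylorAt v (pderiv i F) := by
  induction F using MvPolynomial.induction_on with
  | C a =>
    rw [show taylorAt v (C a) = Polynomial.C (C a) from by
      simp [taylorAt, Polynomial.algebraMap_apply, MvPolynomial.algebraMap_eq]]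
    simp
  | add p q hp hq => simp only [map_add, hp, hq, mul_add, Finset.sum_add_distrib]
  | mul_X p j hp =>
    have hX : taylorAt v (X j) = Polynomial.C (C (v j)) + Polynomial.X * Polynomial.C (X j) := by
      simp [taylorAt]
    have hd : ∀ i, taylorAt v (pderiv i (p * X j)) =
        taylorAt v p * (if j = i then 1 else 0) + taylorAt v (X j) * taylorAt v (pderiv i p) := by
      intro i
      have hij : pderiv i (X j : MvPolynomial (Fin 3) ℂ) = if j = i then 1 else 0 := by
        by_cases h : j = i
        · subst h; simp
        · rw [pderiv_X_of_ne h, if_neg h]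
      rw [Derivation.leibniz, smul_eq_mul, smul_eq_mul, map_add, map_mul, map_mul, hij,
        apply_ite (taylorAt v), map_one, map_zero]
    simp only [hd, map_mul, Polynomial.derivative_mul, hp, mul_add, Finset.sum_add_distrib]
    rw [hX]
    simp only [Polynomial.derivative_add, Polynomial.derivative_C, Polynomial.derivative_mul,
      Polynomial.derivative_X]
    simp only [mul_ite, mul_one, mul_zero, Finset.sum_ite_eq, Finset.mem_univ, if_true,
      zero_add, one_mul, add_zero, Finset.sum_mul]
    rw [add_comm, mul_comm (taylorAt v p)]
    refine (add_right_inj _).2 (Finset.sum_congr rfl fun i _ => ?_)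
    rw [mul_assoc, mul_comm (taylorAt v (pderiv i p))]

theorem coeff_zero_taylorAt (v : Fin 3 → ℂ) (F : MvPolynomial (Fin 3) ℂ) :
    (taylorAt v F).coeff 0 = C (eval v F) := by
  induction F using MvPolynomial.induction_on with
  | C a => simp [taylorAt, Polynomial.algebraMap_apply, MvPolynomial.algebraMap_eq]
  | add p q hp hq => simp [hp, hq]
  | mul_X p j hp =>
    rw [map_mul, Polynomial.mul_coeff_zero, hp]
    simp [taylorAt]

theorem X_pow_dvd_taylorAt {m : ℕ} {F : MvPolynomial (Fin 3) ℂ} {v : Fin 3 → ℂ}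
    (h : VanishesToOrder m F v) : Polynomial.X ^ m ∣ taylorAt v F := by
  induction m generalizing F with
  | zero => simp
  | succ m ih =>
    rw [vanishesToOrder_succ] at h
    have hd : Polynomial.X ^ m ∣ Polynomial.derivative (taylorAt v F) := by
      rw [derivative_taylorAt]
      exact Finset.dvd_sum fun i _ => Dvd.dvd.mul_left (ih (h.2 i)) _
    rw [Polynomial.X_pow_dvd_iff] at hd ⊢
    intro k hk
    rcases k with _ | k
    · rw [coeff_zero_taylorAt, h.1, C_0]
    · have := hd k (by omega)
      rw [Polynomial.coeff_derivative] at this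
      have h2 : ((k : MvPolynomial (Fin 3) ℂ) + 1) ≠ 0 := by exact_mod_cast Nat.succ_ne_zero k
      exact (mul_eq_zero.1 this).resolve_right h2

theorem MvPolynomial.IsHomogeneous.eval_smul_eq {F : MvPolynomial (Fin 3) ℂ} {d : ℕ}
    (hF : F.IsHomogeneous d) (c : ℂ) (v : Fin 3 → ℂ) : eval (c • v) F = c ^ d * eval v F := by
  rw [eval_eq, eval_eq, Finset.mul_sum]
  refine Finset.sum_congr rfl fun s hs => ?_
  have hd := hF.degree_eq_sum_deg_support hs
  simp only [Pi.smul_apply, smul_eq_mul, mul_pow, Finset.prod_mul_distrib]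
  rw [Finset.prod_pow_eq_pow_sum, ← hd]
  ring

theorem memLine_mk_iff {F : MvPolynomial (Fin 3) ℂ} {d : ℕ} (hF : F.IsHomogeneous d)
    {v : Fin 3 → ℂ} (hv : v ≠ 0) : MemLine F (Projectivization.mk ℂ v hv) ↔ eval v F = 0 := by
  refine ⟨fun h => h v hv rfl, fun h w hw hwv => ?_⟩
  obtain ⟨a, rfl⟩ := (Projectivization.mk_eq_mk_iff' ℂ w v hw hv).1 hwv
  rw [hF.eval_smul_eq, h, mul_zero]

theorem memLine_iff_rep {F : MvPolynomial (Fin 3) ℂ} {d : ℕ} (hF : F.IsHomogeneous d)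
    (P : Plane) : MemLine F P ↔ eval P.rep F = 0 := by
  conv_lhs => rw [← P.mk_rep]
  exact memLine_mk_iff hF P.rep_nonzero

/-- `F` has order at least `m` at the projective point `P`, in terms of Taylor expansions. -/
def HasOrderAt (m : ℕ) (F : MvPolynomial (Fin 3) ℂ) (P : Plane) : Prop :=
  ∀ (v : Fin 3 → ℂ) (hv : v ≠ 0), Projectivization.mk ℂ v hv = P →
    Polynomial.X ^ m ∣ taylorAt v F

theorem hasOrderAt_of_mem_symbolicPower {Z : Set Plane} {m : ℕ} {F : MvPolynomial (Fin 3) ℂ}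
    (hF : F ∈ symbolicPower Z m) {P : Plane} (hP : P ∈ Z) : HasOrderAt m F P :=
  fun v hv h => X_pow_dvd_taylorAt (hF P hP v hv h)

/-- A polynomial all of whose projective zeros are simple. -/
def IsSmoothForm (C : MvPolynomial (Fin 3) ℂ) : Prop :=
  ∀ v : Fin 3 → ℂ, v ≠ 0 → ¬ Polynomial.X ^ 2 ∣ taylorAt v C

theorem HasOrderAt.of_mul_of_not_memLine {C G : MvPolynomial (Fin 3) ℂ} {e m : ℕ}
    (hC : C.IsHomogeneous e) {P : Plane} (h : HasOrderAt m (C * G) P) (hP : ¬ MemLine C P) :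
    HasOrderAt m G P := by
  rintro v hv rfl
  refine Polynomial.prime_X.pow_dvd_of_dvd_mul_left m ?_ (by simpa using h v hv rfl)
  rw [Polynomial.X_dvd_iff, coeff_zero_taylorAt]
  rw [memLine_mk_iff hC hv] at hP
  simpa using hP

theorem HasOrderAt.of_mul_of_isSmoothForm {C G : MvPolynomial (Fin 3) ℂ} {m : ℕ}
    (hC : IsSmoothForm C) {P : Plane} (h : HasOrderAt m (C * G) P) : HasOrderAt (m - 1) G P := by
  rintro v hv rfl
  have h' := h v hv rfl
  rw [map_mul] at h'
  by_cases hX : Polynomial.X ∣ taylorAt v C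
  · rcases m with _ | m
    · simp
    obtain ⟨A, hA⟩ := hX
    have hA' : ¬ Polynomial.X ∣ A := by
      rintro ⟨B, rfl⟩
      exact hC v hv ⟨B, by rw [hA]; ring⟩
    rw [hA, pow_succ', mul_assoc] at h'
    exact Polynomial.prime_X.pow_dvd_of_dvd_mul_left m hA'
      ((mul_dvd_mul_iff_left Polynomial.X_ne_zero).1 h')
  · exact (pow_dvd_pow _ (Nat.sub_le m 1)).trans
      (Polynomial.prime_X.pow_dvd_of_dvd_mul_left m hX h')

theorem MvPolynomial.IsHomogeneous.of_mul_left_of_isHomogeneous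
    {C G : MvPolynomial (Fin 3) ℂ} {e d : ℕ} (hC : C.IsHomogeneous e) (hC0 : C ≠ 0)
    (hG : G ≠ 0) (h : (C * G).IsHomogeneous d) : e ≤ d ∧ G.IsHomogeneous (d - e) := by
  have hcomp : ∀ k, homogeneousComponent (e + k) (C * G) = C * homogeneousComponent k G := by
    intro k
    let := MvPolynomial.gradedAlgebra (σ := Fin 3) (R := ℂ)
    have h := DirectSum.coe_decompose_mul_add_of_left_mem
      (homogeneousSubmodule (Fin 3) ℂ) (i := e) (j := k) (b := G) hC
    have hd : ∀ (φ : MvPolynomial (Fin 3) ℂ) i, ((DirectSum.decompose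
        (homogeneousSubmodule (Fin 3) ℂ) φ i : homogeneousSubmodule (Fin 3) ℂ i) :
        MvPolynomial (Fin 3) ℂ) = homogeneousComponent i φ :=
      decomposition.decompose'_apply
    rwa [hd, hd] at h
  have hk : ∀ k, homogeneousComponent k G ≠ 0 → e + k = d := by
    intro k hk
    by_contra hne
    have h1 := hcomp k
    rw [homogeneousComponent_of_mem ((mem_homogeneousSubmodule d _).2 h), if_neg hne] at h1
    exact mul_ne_zero hC0 hk h1.symm
  have hex : ∃ k, homogeneousComponent k G ≠ 0 := by
    by_contra! hall
    apply hG
    rw [← sum_homogeneousComponent G]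
    exact Finset.sum_eq_zero fun i _ => hall i
  obtain ⟨k, hk0⟩ := hex
  have hkd := hk k hk0
  refine ⟨by omega, ?_⟩
  have : G = homogeneousComponent k G := by
    conv_lhs => rw [← sum_homogeneousComponent G]
    refine Finset.sum_eq_single k (fun j _ hj => ?_) (fun hnot => ?_)
    · by_contra hj0
      have := hk j hj0
      omega
    · apply homogeneousComponent_eq_zero
      simpa using hnot
  rw [this, show d - e = k by omega]
  exact homogeneousComponent_isHomogeneous k G

open Classical in
/-- To bound the weighted orders of vanishing of forms at given points, it suffices to treat the
forms that are not divisible by any smooth form meeting the weights non-negatively. -/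
theorem sum_weight_mul_order_le {ι : Type*} [Fintype ι] (p : ι → Plane) (n : ι → ℕ) (t : ℕ)
    (H : ∀ (F : MvPolynomial (Fin 3) ℂ) (d : ℕ) (μ : ι → ℕ), F ≠ 0 → F.IsHomogeneous d →
      (∀ i, HasOrderAt (μ i) F (p i)) →
      (∀ (C : MvPolynomial (Fin 3) ℂ) (e : ℕ), C.IsHomogeneous e → 0 < e → IsSmoothForm C →
        ∑ i, (if MemLine C (p i) then n i else 0) ≤ t * e → ¬ C ∣ F) →
      ∑ i, n i * μ i ≤ t * d)
    (F : MvPolynomial (Fin 3) ℂ) (d : ℕ) (μ : ι → ℕ) (hF0 : F ≠ 0) (hF : F.IsHomogeneous d)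
    (hμ : ∀ i, HasOrderAt (μ i) F (p i)) : ∑ i, n i * μ i ≤ t * d := by
  induction d using Nat.strong_induction_on generalizing F μ with
  | _ d ih =>
    by_cases hdiv : ∃ (C : MvPolynomial (Fin 3) ℂ) (e : ℕ), C.IsHomogeneous e ∧ 0 < e ∧
        IsSmoothForm C ∧ ∑ i, (if MemLine C (p i) then n i else 0) ≤ t * e ∧ C ∣ F
    · obtain ⟨C, e, hC, he, hs, hn, G, rfl⟩ := hdiv
      have hC0 := left_ne_zero_of_mul hF0
      have hG0 := right_ne_zero_of_mul hF0
      obtain ⟨hed, hG⟩ := hC.of_mul_left_of_isHomogeneous hC0 hG0 hF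
      have key := ih (d - e) (by omega) G (fun i => μ i - if MemLine C (p i) then 1 else 0)
        hG0 hG (fun i => by
          by_cases hi : MemLine C (p i)
          · simpa [hi] using (hμ i).of_mul_of_isSmoothForm hs
          · simpa [hi] using (hμ i).of_mul_of_not_memLine hC hi)
      calc ∑ i, n i * μ i
          ≤ ∑ i, (n i * (μ i - if MemLine C (p i) then 1 else 0) +
              if MemLine C (p i) then n i else 0) := by
            refine Finset.sum_le_sum fun i _ => ?_
            split_ifs
            · rw [← Nat.mul_succ]
              exact Nat.mul_le_mul_left _ (by omega)
            · simp
        _ ≤ t * (d - e) + t * e := by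
            rw [Finset.sum_add_distrib]
            exact add_le_add key hn
        _ = t * d := by rw [← mul_add, Nat.sub_add_cancel hed]
    · push Not at hdiv
      exact H F d μ hF0 hF hμ hdiv

theorem X_sub_C_pow_dvd_aeval {F : MvPolynomial (Fin 3) ℂ} {m : ℕ} {g : Fin 3 → Polynomial ℂ}
    {x : ℂ} {v : Fin 3 → ℂ} (hg : ∀ i, (g i).eval x = v i)
    (h : Polynomial.X ^ m ∣ taylorAt v F) : (Polynomial.X - Polynomial.C x) ^ m ∣ aeval g F := by
  have hh : ∀ i, ∃ q, g i = Polynomial.C (v i) + (Polynomial.X - Polynomial.C x) * q := by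
    intro i
    obtain ⟨q, hq⟩ := Polynomial.X_sub_C_dvd_sub_C_eval (a := x) (p := g i)
    exact ⟨q, by rw [← hq, hg]; ring⟩
  choose q hq using hh
  let Ψ : Polynomial (MvPolynomial (Fin 3) ℂ) →+* Polynomial ℂ :=
    Polynomial.eval₂RingHom (aeval q).toRingHom (Polynomial.X - Polynomial.C x)
  have hΨ : Ψ.comp (taylorAt v).toRingHom = (aeval g).toRingHom := by
    refine MvPolynomial.ringHom_ext (fun a => ?_) (fun i => ?_)
    · simp [Ψ, taylorAt, Polynomial.algebraMap_apply, MvPolynomial.algebraMap_eq]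
    · simp [Ψ, taylorAt, hq, ← MvPolynomial.algebraMap_eq]
      ring
  have := map_dvd Ψ h
  rw [map_pow, show Ψ Polynomial.X = Polynomial.X - Polynomial.C x by simp [Ψ]] at this
  have h2 : Ψ (taylorAt v F) = aeval g F := congrArg (fun f => f F) hΨ
  rwa [h2] at this

theorem natDegree_aeval_le {F : MvPolynomial (Fin 3) ℂ} {d e : ℕ} (hF : F.IsHomogeneous d)
    {g : Fin 3 → Polynomial ℂ} (hg : ∀ i, (g i).natDegree ≤ e) :
    (aeval g F).natDegree ≤ e * d := by
  rw [aeval_def, eval₂_eq]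
  refine Polynomial.natDegree_sum_le_of_forall_le _ _ fun s hs => ?_
  refine (Polynomial.natDegree_C_mul_le _ _).trans ?_
  refine (Polynomial.natDegree_prod_le _ _).trans ?_
  rw [hF.degree_eq_sum_deg_support hs, Finset.mul_sum]
  refine Finset.sum_le_sum fun i _ => ?_
  refine Polynomial.natDegree_pow_le.trans ?_
  rw [mul_comm]
  exact Nat.mul_le_mul_right _ (hg i)

/-- Counting the zeros of `F` along a parametrised rational curve of degree `e`. -/
theorem sum_order_le_of_param {κ : Type*} [Fintype κ] {F : MvPolynomial (Fin 3) ℂ} {d e : ℕ}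
    (hF : F.IsHomogeneous d) {g : Fin 3 → Polynomial ℂ} (hg : ∀ i, (g i).natDegree ≤ e)
    {p : κ → Plane} (hp : Function.Injective p) {x : κ → ℂ}
    (hx : ∀ k, ∃ (hv : (fun i => (g i).eval (x k)) ≠ 0), Projectivization.mk ℂ _ hv = p k)
    {μ : κ → ℕ} (hμ : ∀ k, HasOrderAt (μ k) F (p k)) (h0 : aeval g F ≠ 0) :
    ∑ k, μ k ≤ e * d := by
  have hxi : Function.Injective x := by
    intro a b hab
    obtain ⟨ha, ha'⟩ := hx a
    obtain ⟨hb, hb'⟩ := hx b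
    apply hp
    rw [← ha', ← hb']
    simp only [hab]
  have hdvd : ∏ k, (Polynomial.X - Polynomial.C (x k)) ^ μ k ∣ aeval g F := by
    refine Finset.prod_dvd_of_coprime (fun a _ b _ hab => ?_) (fun k _ => ?_)
    · exact (Polynomial.isCoprime_X_sub_C_of_isUnit_sub
        (sub_ne_zero.2 (hxi.ne hab)).isUnit).pow
    · obtain ⟨hv, hv'⟩ := hx k
      exact X_sub_C_pow_dvd_aeval (fun _ => rfl) (hμ k _ hv hv')
  calc ∑ k, μ k = (∏ k, (Polynomial.X - Polynomial.C (x k)) ^ μ k).natDegree := by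
        rw [Polynomial.natDegree_prod _ _ fun k _ => pow_ne_zero _ (Polynomial.X_sub_C_ne_zero _)]
        simp
    _ ≤ (aeval g F).natDegree := Polynomial.natDegree_le_of_dvd hdvd h0
    _ ≤ e * d := natDegree_aeval_le hF hg

open scoped Matrix in
theorem exists_eq_smul_of_cross_eq_zero {u v : Fin 3 → ℂ} (hu : u ≠ 0)
    (h : crossProduct u v = 0) : ∃ c : ℂ, v = c • u := by
  by_cases hv : v = 0
  · exact ⟨0, by simp [hv]⟩
  · obtain ⟨c, hc⟩ := (Projectivization.mk_eq_mk_iff' ℂ v u hv hu).1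
      ((Projectivization.mk_eq_mk_iff_crossProduct_eq_zero hu hv).2 h).symm
    exact ⟨c, hc.symm⟩

theorem exists_eq_smul_add_smul {a o w v : Fin 3 → ℂ} (ha : a ≠ 0) (ho : a ⬝ᵥ o = 0)
    (hw : a ⬝ᵥ w = 0) (hv : a ⬝ᵥ v = 0) (how : crossProduct o w ≠ 0) :
    ∃ α β : ℂ, v = α • o + β • w := by
  have hdet : crossProduct o w ⬝ᵥ v = 0 := by
    obtain ⟨i, hi⟩ := Function.ne_iff.1 ha
    refine (mul_eq_zero.1 (?_ : a i * _ = 0)).resolve_left hi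
    simp only [dotProduct, Fin.sum_univ_three, cross_apply, Matrix.cons_val] at *
    fin_cases i <;> simp only [Fin.zero_eta, Fin.mk_one, Fin.reduceFinMk]
    · linear_combination (w 1 * v 2 - w 2 * v 1) * ho + (v 1 * o 2 - v 2 * o 1) * hw +
        (o 1 * w 2 - o 2 * w 1) * hv
    · linear_combination (w 2 * v 0 - w 0 * v 2) * ho + (v 2 * o 0 - v 0 * o 2) * hw +
        (o 2 * w 0 - o 0 * w 2) * hv
    · linear_combination (w 0 * v 1 - w 1 * v 0) * ho + (v 0 * o 1 - v 1 * o 0) * hw +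
        (o 0 * w 1 - o 1 * w 0) * hv
  obtain ⟨j, hj⟩ := Function.ne_iff.1 how
  refine ⟨crossProduct v w j / crossProduct o w j, crossProduct o v j / crossProduct o w j, ?_⟩
  simp only [Pi.zero_apply] at hj
  ext i
  simp only [Pi.add_apply, Pi.smul_apply, smul_eq_mul]
  field_simp
  simp only [dotProduct, Fin.sum_univ_three, cross_apply, Matrix.cons_val] at hdet
  fin_cases i <;> fin_cases j <;> simp [cross_apply] <;>
    first | linear_combination hdet | linear_combination (0 : ℂ) * hdet

theorem exists_dotProduct_ne_zero {κ : Type*} [Finite κ] {q : κ → Fin 3 → ℂ}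
    (hq : ∀ k, q k ≠ 0) : ∃ b : Fin 3 → ℂ, ∀ k, b ⬝ᵥ q k ≠ 0 := by
  obtain ⟨f, hf⟩ := Module.exists_dual_forall_apply_ne_zero (K := ℂ) q hq
  refine ⟨fun i => f (Pi.single i 1), fun k h => hf k ?_⟩
  rw [LinearMap.pi_apply_eq_sum_univ f]
  refine Eq.trans (Finset.sum_congr rfl fun i _ => ?_) h
  rw [smul_eq_mul, mul_comm]
  congr 2
  ext j
  simp [Pi.single_apply, eq_comm]

/-- The linear form with coefficients `a`. -/
noncomputable def linForm (a : Fin 3 → ℂ) : MvPolynomial (Fin 3) ℂ := ∑ i, C (a i) * X i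

@[simp]
theorem eval_linForm (a v : Fin 3 → ℂ) : eval v (linForm a) = a ⬝ᵥ v := by
  simp [linForm, dotProduct]

theorem isHomogeneous_linForm (a : Fin 3 → ℂ) : (linForm a).IsHomogeneous 1 :=
  IsHomogeneous.sum _ _ _ fun i _ => isHomogeneous_C_mul_X (a i) i

theorem linForm_ne_zero {a : Fin 3 → ℂ} (ha : a ≠ 0) : linForm a ≠ 0 := by
  obtain ⟨b, hb⟩ := exists_dotProduct_ne_zero (κ := Unit) (q := fun _ => a) fun _ => ha
  intro h
  have := congrArg (eval b) h
  rw [eval_linForm, dotProduct_comm] at this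
  exact hb () (by simpa using this)

theorem isLine_linForm {a : Fin 3 → ℂ} (ha : a ≠ 0) : IsLine (linForm a) :=
  ⟨linForm_ne_zero ha, isHomogeneous_linForm a⟩

theorem IsLine.exists_eq_linForm {L : MvPolynomial (Fin 3) ℂ} (hL : IsLine L) :
    ∃ a : Fin 3 → ℂ, a ≠ 0 ∧ L = linForm a := by
  have h := (mem_homogeneousSubmodule 1 L).2 hL.2
  rw [homogeneousSubmodule_one_eq_span_X, Submodule.mem_span_range_iff_exists_fun] at h
  obtain ⟨a, ha⟩ := h
  have hLa : L = linForm a := by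
    rw [← ha, linForm]
    simp [smul_eq_C_mul]
  refine ⟨a, ?_, hLa⟩
  rintro rfl
  exact hL.1 (by simp [hLa, linForm])

theorem memLine_linForm (a : Fin 3 → ℂ) (P : Plane) :
    MemLine (linForm a) P ↔ a ⬝ᵥ P.rep = 0 := by
  rw [memLine_iff_rep (isHomogeneous_linForm a), eval_linForm]

theorem IsLine.irreducible {L : MvPolynomial (Fin 3) ℂ} (hL : IsLine L) : Irreducible L := by
  refine irreducible_of_totalDegree_eq_one (hL.2.totalDegree hL.1) fun x hx => ?_
  rw [isUnit_iff_ne_zero]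
  rintro rfl
  apply hL.1
  ext i
  simpa using hx i

theorem taylorAt_linForm (a v : Fin 3 → ℂ) :
    taylorAt v (linForm a) =
      Polynomial.C (C (a ⬝ᵥ v)) + Polynomial.X * Polynomial.C (linForm a) := by
  simp only [linForm, taylorAt, map_mul, aeval_C, aeval_X, dotProduct,
    Polynomial.algebraMap_apply, MvPolynomial.algebraMap_eq, Fin.sum_univ_three, map_add]
  ring

theorem IsLine.isSmoothForm {L : MvPolynomial (Fin 3) ℂ} (hL : IsLine L) : IsSmoothForm L := by
  obtain ⟨a, ha, rfl⟩ := hL.exists_eq_linForm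
  intro v _ h
  rw [taylorAt_linForm, Polynomial.X_pow_dvd_iff] at h
  exact hL.1 (by simpa [Polynomial.coeff_C] using h 1 one_lt_two)

instance : Nontrivial Plane := by
  refine ⟨.mk ℂ ![1, 0, 0] (by simp), .mk ℂ ![0, 1, 0] (by simp), fun h => ?_⟩
  obtain ⟨a, ha⟩ := (Projectivization.mk_eq_mk_iff' ℂ _ _ _ _).1 h
  simpa using congrFun ha 0

theorem cross_rep_ne_zero {P Q : Plane} (h : P ≠ Q) : crossProduct P.rep Q.rep ≠ 0 := by
  intro h0
  apply h
  rw [← P.mk_rep, ← Q.mk_rep]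
  exact (Projectivization.mk_eq_mk_iff_crossProduct_eq_zero P.rep_nonzero Q.rep_nonzero).2 h0

theorem exists_line_through (P Q : Plane) : ∃ L, IsLine L ∧ MemLine L P ∧ MemLine L Q := by
  have key : ∀ P Q : Plane, P ≠ Q → ∃ L, IsLine L ∧ MemLine L P ∧ MemLine L Q := by
    intro P Q h
    refine ⟨_, isLine_linForm (cross_rep_ne_zero h), ?_, ?_⟩ <;> rw [memLine_linForm]
    · rw [dotProduct_comm, dot_self_cross]
    · rw [dotProduct_comm, dot_cross_self]
  by_cases h : P = Q
  · subst h
    obtain ⟨b, hb⟩ := exists_ne P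
    obtain ⟨L, hL, h1, -⟩ := key P b hb.symm
    exact ⟨L, hL, h1, h1⟩
  · exact key P Q h

theorem IsLine.memLine_iff_of_two_points {L M : MvPolynomial (Fin 3) ℂ} (hL : IsLine L)
    (hM : IsLine M) {P Q : Plane} (hPQ : P ≠ Q) (hLP : MemLine L P) (hLQ : MemLine L Q)
    (hMP : MemLine M P) (hMQ : MemLine M Q) (x : Plane) : MemLine L x ↔ MemLine M x := by
  obtain ⟨a, ha, rfl⟩ := hL.exists_eq_linForm
  obtain ⟨b, hb, rfl⟩ := hM.exists_eq_linForm
  simp only [memLine_linForm] at *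
  have key : ∀ {a b : Fin 3 → ℂ}, a ≠ 0 → a ⬝ᵥ P.rep = 0 → a ⬝ᵥ Q.rep = 0 → b ⬝ᵥ P.rep = 0 →
      b ⬝ᵥ Q.rep = 0 → a ⬝ᵥ x.rep = 0 → b ⬝ᵥ x.rep = 0 := by
    intro a b ha h1 h2 h3 h4 h5
    obtain ⟨α, β, h⟩ := exists_eq_smul_add_smul ha h1 h2 h5 (cross_rep_ne_zero hPQ)
    rw [h, dotProduct_add, dotProduct_smul, dotProduct_smul, h3, h4]
    simp
  exact ⟨key ha hLP hLQ hMP hMQ, key hb hMP hMQ hLP hLQ⟩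

theorem exists_line_through_avoiding {κ : Type*} [Finite κ] (P : Plane) {q : κ → Plane}
    (hq : ∀ k, q k ≠ P) : ∃ L, IsLine L ∧ MemLine L P ∧ ∀ k, ¬ MemLine L (q k) := by
  obtain ⟨Q, hQ⟩ := exists_ne P
  obtain ⟨b, hb⟩ := exists_dotProduct_ne_zero (κ := Option κ)
    (q := fun k => crossProduct (k.elim Q q).rep P.rep) (by
      rintro (_ | k)
      · exact cross_rep_ne_zero hQ
      · exact cross_rep_ne_zero (hq k))
  have hdot : ∀ R : Plane, crossProduct P.rep b ⬝ᵥ R.rep = b ⬝ᵥ crossProduct R.rep P.rep := by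
    intro R
    rw [dotProduct_comm, triple_product_permutation, triple_product_permutation]
  refine ⟨linForm (crossProduct P.rep b), isLine_linForm ?_, ?_, fun k => ?_⟩
  · intro h0
    have h1 := hdot Q
    rw [h0, zero_dotProduct] at h1
    exact hb none h1.symm
  · rw [memLine_linForm, hdot, cross_self, dotProduct_zero]
  · rw [memLine_linForm, hdot]
    exact hb (some k)

theorem exists_line_avoiding {κ : Type*} [Finite κ] (q : κ → Plane) :
    ∃ L, IsLine L ∧ ∀ k, ¬ MemLine L (q k) := by
  obtain ⟨b, hb⟩ := exists_dotProduct_ne_zero (κ := Option κ)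
    (q := fun k => k.elim 1 fun k => (q k).rep) (by
      rintro (_ | k)
      · exact one_ne_zero
      · exact (q k).rep_nonzero)
  refine ⟨linForm b, isLine_linForm ?_, fun k => ?_⟩
  · rintro rfl
    exact hb none (by simp)
  · rw [memLine_linForm]
    exact hb (some k)

theorem eval_aeval_polynomial (g : Fin 3 → Polynomial ℂ) (x : ℂ) (F : MvPolynomial (Fin 3) ℂ) :
    (aeval g F).eval x = eval (fun i => (g i).eval x) F := by
  have h : (aeval fun i => (g i).eval x : MvPolynomial (Fin 3) ℂ →ₐ[ℂ] ℂ) =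
      (Polynomial.aeval x).comp (aeval g) := by
    ext i
    simp
  simpa [Polynomial.aeval_def] using (congrArg (fun f => f F) h).symm

/-- If `F` vanishes along a parametrization of the part of an irreducible curve `C` off a curve
`M`, then `C` divides `F`. -/
theorem dvd_of_aeval_param_eq_zero {C M F : MvPolynomial (Fin 3) ℂ} (hC : Irreducible C)
    (hM : ¬ C ∣ M) {g : Fin 3 → Polynomial ℂ}
    (h : ∀ v, eval v C = 0 → eval v M ≠ 0 → ∃ c x : ℂ, v = c • fun i => (g i).eval x)
    {d : ℕ} (hF : F.IsHomogeneous d) (hg : aeval g F = 0) : C ∣ F := by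
  have hprime : Prime C := hC.prime
  have hI : (Ideal.span {C}).IsPrime := (Ideal.span_singleton_prime hC.ne_zero).2 hprime
  have hmem : F * M ∈ vanishingIdeal ℂ (zeroLocus ℂ (Ideal.span {C})) := by
    rw [mem_vanishingIdeal_iff]
    intro v hv
    have hv0 : eval v C = 0 := by
      simpa using hv C (Ideal.mem_span_singleton_self C)
    by_cases hMv : eval v M = 0
    · simp [hMv]
    · obtain ⟨c, x, rfl⟩ := h v hv0 hMv
      simp [hF.eval_smul_eq, ← eval_aeval_polynomial, hg]
  rw [IsPrime.vanishingIdeal_zeroLocus, Ideal.mem_span_singleton] at hmem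
  exact (hprime.dvd_or_dvd hmem).resolve_right hM

/-- Bézout's inequality for a line. -/
theorem IsLine.sum_order_le {L : MvPolynomial (Fin 3) ℂ} (hL : IsLine L) {κ : Type*} [Fintype κ]
    {F : MvPolynomial (Fin 3) ℂ} {d : ℕ} (hF : F.IsHomogeneous d) {p : κ → Plane}
    (hp : Function.Injective p) (hpL : ∀ k, MemLine L (p k)) {μ : κ → ℕ}
    (hμ : ∀ k, HasOrderAt (μ k) F (p k)) (hLF : ¬ L ∣ F) : ∑ k, μ k ≤ d := by
  obtain ⟨a, ha, rfl⟩ := hL.exists_eq_linForm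
  obtain _ | ⟨⟨k₀⟩⟩ := isEmpty_or_nonempty κ
  · simp
  obtain ⟨b, hb⟩ := exists_dotProduct_ne_zero (q := fun k => (p k).rep)
    fun k => (p k).rep_nonzero
  simp only [memLine_linForm] at hpL
  set w := (b ⬝ᵥ (p k₀).rep)⁻¹ • (p k₀).rep with hw
  have hbw : b ⬝ᵥ w = 1 := by
    rw [hw, dotProduct_smul, smul_eq_mul, inv_mul_cancel₀ (hb k₀)]
  have haw : a ⬝ᵥ w = 0 := by rw [hw, dotProduct_smul, hpL, smul_zero]
  set u := crossProduct a b with hu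
  have hau : a ⬝ᵥ u = 0 := dot_self_cross a b
  have hbu : b ⬝ᵥ u = 0 := dot_cross_self a b
  have hu0 : u ≠ 0 := by
    intro h0
    obtain ⟨c, rfl⟩ := exists_eq_smul_of_cross_eq_zero ha h0
    exact hb k₀ (by rw [smul_dotProduct, hpL, smul_zero])
  have huw : crossProduct w u ≠ 0 := by
    intro h0
    rw [← cross_anticomm, neg_eq_zero] at h0
    obtain ⟨c, hc⟩ := exists_eq_smul_of_cross_eq_zero hu0 h0
    rw [hc, dotProduct_smul, hbu] at hbw
    simp at hbw
  have hparam : ∀ v, a ⬝ᵥ v = 0 → b ⬝ᵥ v ≠ 0 → ∃ x : ℂ, v = (b ⬝ᵥ v) • fun i =>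
      ((Polynomial.C (w i) + Polynomial.X * Polynomial.C (u i) : Polynomial ℂ)).eval x := by
    intro v hv hbv
    obtain ⟨α, β, rfl⟩ := exists_eq_smul_add_smul ha haw hau hv huw
    have hα : b ⬝ᵥ (α • w + β • u) = α := by
      simp [dotProduct_add, dotProduct_smul, hbw, hbu]
    rw [hα] at hbv ⊢
    refine ⟨β / α, ?_⟩
    ext i
    simp
    field_simp
  have hx : ∀ k, ∃ x : ℂ, ∃ (hv : (fun i => ((Polynomial.C (w i) +
      Polynomial.X * Polynomial.C (u i) : Polynomial ℂ)).eval x) ≠ 0),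
      Projectivization.mk ℂ _ hv = p k := by
    intro k
    obtain ⟨x, hx⟩ := hparam _ (hpL k) (hb k)
    have hv : (fun i => ((Polynomial.C (w i) +
      Polynomial.X * Polynomial.C (u i) : Polynomial ℂ)).eval x) ≠ 0 := by
      intro h0
      rw [h0, smul_zero] at hx
      exact (p k).rep_nonzero hx
    refine ⟨x, hv, ?_⟩
    conv_rhs => rw [← (p k).mk_rep]
    exact ((Projectivization.mk_eq_mk_iff' ℂ _ _ (p k).rep_nonzero hv).2 ⟨_, hx.symm⟩).symm
  choose x hx using hx
  have hdeg : ∀ i, (Polynomial.C (w i) + Polynomial.X * Polynomial.C (u i)).natDegree ≤ 1 := by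
    intro i
    compute_degree
  rw [← one_mul d]
  refine sum_order_le_of_param hF hdeg hp hx hμ fun h0 => hLF ?_
  refine dvd_of_aeval_param_eq_zero (M := linForm b) hL.irreducible (fun hdvd => ?_)
    (fun v hv hMv => ?_) hF h0
  · obtain ⟨G, hG⟩ := hdvd
    have := congrArg (eval w) hG
    rw [map_mul, eval_linForm, eval_linForm, haw, hbw] at this
    simp at this
  · rw [eval_linForm] at hv hMv
    obtain ⟨x, hx⟩ := hparam v hv hMv
    exact ⟨_, x, hx⟩

theorem MvPolynomial.IsHomogeneous.exists_eq_linForm {L : MvPolynomial (Fin 3) ℂ}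
    (hL : L.IsHomogeneous 1) : ∃ a : Fin 3 → ℂ, L = linForm a := by
  by_cases h : L = 0
  · exact ⟨0, by simp [h, linForm]⟩
  · obtain ⟨a, -, ha⟩ := IsLine.exists_eq_linForm ⟨h, hL⟩
    exact ⟨a, ha⟩

/-- The polar form of a quadratic form. -/
theorem MvPolynomial.IsHomogeneous.exists_polar {Q : MvPolynomial (Fin 3) ℂ}
    (hQ : Q.IsHomogeneous 2) : ∃ B : (Fin 3 → ℂ) →ₗ[ℂ] (Fin 3 → ℂ) →ₗ[ℂ] ℂ,
      ∀ (α β : ℂ) (o w : Fin 3 → ℂ),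
        eval (α • o + β • w) Q = α ^ 2 * eval o Q + α * β * B o w + β ^ 2 * eval w Q := by
  have h := (mem_homogeneousSubmodule 2 Q).2 hQ
  rw [← homogeneousSubmodule_one_pow, pow_two] at h
  induction h using Submodule.mul_induction_on' with
  | mem_mul_mem f hf g hg =>
    obtain ⟨a, rfl⟩ := ((mem_homogeneousSubmodule 1 f).1 hf).exists_eq_linForm
    obtain ⟨b, rfl⟩ := ((mem_homogeneousSubmodule 1 g).1 hg).exists_eq_linForm
    refine ⟨LinearMap.mk₂ ℂ (fun o w => (a ⬝ᵥ o) * (b ⬝ᵥ w) + (a ⬝ᵥ w) * (b ⬝ᵥ o))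
      ?_ ?_ ?_ ?_, ?_⟩
    all_goals intros; simp [dotProduct_add, dotProduct_smul]; ring
  | add f hf g hg ihf ihg =>
    have hf2 : f.IsHomogeneous 2 := by
      rwa [← pow_two, homogeneousSubmodule_one_pow] at hf
    have hg2 : g.IsHomogeneous 2 := by
      rwa [← pow_two, homogeneousSubmodule_one_pow] at hg
    obtain ⟨B, hB⟩ := ihf hf2
    obtain ⟨B', hB'⟩ := ihg hg2
    refine ⟨B + B', fun α β o w => ?_⟩
    simp only [map_add, hB, hB', LinearMap.add_apply]
    ring

theorem IsLine.dvd_of_forall_eval_eq_zero {a : Fin 3 → ℂ} (ha : a ≠ 0)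
    {F : MvPolynomial (Fin 3) ℂ} (h : ∀ v, a ⬝ᵥ v = 0 → eval v F = 0) : linForm a ∣ F := by
  have hirr := (isLine_linForm ha).irreducible
  have hI : (Ideal.span {linForm a}).IsPrime :=
    (Ideal.span_singleton_prime hirr.ne_zero).2 hirr.prime
  have hmem : F ∈ vanishingIdeal ℂ (zeroLocus ℂ (Ideal.span {linForm a})) := by
    rw [mem_vanishingIdeal_iff]
    intro v hv
    have hv0 := hv (linForm a) (Ideal.mem_span_singleton_self _)
    simpa using h v (by simpa using hv0)
  rwa [IsPrime.vanishingIdeal_zeroLocus, Ideal.mem_span_singleton] at hmem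

theorem not_linForm_dvd_of_irreducible {Q : MvPolynomial (Fin 3) ℂ} (hirr : Irreducible Q)
    (hQ : Q.IsHomogeneous 2) {a : Fin 3 → ℂ} (ha : a ≠ 0) : ¬ linForm a ∣ Q := by
  intro hd
  have hassoc := (isLine_linForm ha).irreducible.associated_of_dvd hirr hd
  obtain ⟨G, hG⟩ := hassoc.symm.dvd
  have h1 := isHomogeneous_linForm a
  rw [hG] at h1
  have := (hQ.of_mul_left_of_isHomogeneous hirr.ne_zero (by
    rintro rfl
    exact linForm_ne_zero ha (by simpa using hG)) h1).1
  omega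

theorem cross_eq_zero_of_polar_eq_zero {Q : MvPolynomial (Fin 3) ℂ} (hirr : Irreducible Q)
    (hQ : Q.IsHomogeneous 2) {B : (Fin 3 → ℂ) →ₗ[ℂ] (Fin 3 → ℂ) →ₗ[ℂ] ℂ}
    (hB : ∀ (α β : ℂ) (o w : Fin 3 → ℂ),
      eval (α • o + β • w) Q = α ^ 2 * eval o Q + α * β * B o w + β ^ 2 * eval w Q)
    {o w : Fin 3 → ℂ} (ho : eval o Q = 0) (hw : eval w Q = 0) (how : B o w = 0) :
    crossProduct o w = 0 := by
  by_contra hne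
  refine not_linForm_dvd_of_irreducible hirr hQ hne
    (IsLine.dvd_of_forall_eval_eq_zero hne fun v hv => ?_)
  obtain ⟨α, β, rfl⟩ := exists_eq_smul_add_smul hne
    (by rw [dotProduct_comm, dot_self_cross]) (by rw [dotProduct_comm, dot_cross_self]) hv hne
  rw [hB, ho, hw, how]
  simp

/-- A quadratic form has a zero on every line. -/
theorem exists_zero_on_line {Q : MvPolynomial (Fin 3) ℂ} (hQ : Q.IsHomogeneous 2)
    {a : Fin 3 → ℂ} (ha : a ≠ 0) : ∃ v, v ≠ 0 ∧ a ⬝ᵥ v = 0 ∧ eval v Q = 0 := by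
  obtain ⟨B, hB⟩ := hQ.exists_polar
  obtain ⟨b, hb⟩ := exists_dotProduct_ne_zero (κ := Unit) (q := fun _ => a) fun _ => ha
  obtain ⟨o, w, hao, haw, how⟩ : ∃ o w, a ⬝ᵥ o = 0 ∧ a ⬝ᵥ w = 0 ∧ crossProduct o w ≠ 0 := by
    obtain ⟨i, hi⟩ := Function.ne_iff.1 ha
    refine ⟨crossProduct a (Pi.single (i + 1) 1), crossProduct a (Pi.single (i + 2) 1),
      dot_self_cross _ _, dot_self_cross _ _, fun h0 => hi ?_⟩
    have := congrFun h0 i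
    simp only [cross_apply] at this
    fin_cases i <;> simpa using this
  by_cases ho : eval o Q = 0
  · exact ⟨o, by rintro rfl; simp at how, hao, ho⟩
  · obtain ⟨x, hx⟩ := exists_quadratic_eq_zero ho
      ((IsAlgClosed.exists_pow_nat_eq (discrim (eval o Q) (B o w) (eval w Q)) two_pos).imp
        fun s hs => by rw [← hs, pow_two])
    refine ⟨x • o + (1 : ℂ) • w, fun h0 => how ?_, ?_, ?_⟩
    · have : w = (-x) • o := by
        rw [one_smul, add_comm, add_eq_zero_iff_eq_neg] at h0
        rw [h0, neg_smul]
      rw [this, map_smul, cross_self, smul_zero]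
    · simp [dotProduct_add, dotProduct_smul, hao, haw]
    · rw [hB]
      linear_combination hx

theorem isSmoothForm_of_irreducible {Q : MvPolynomial (Fin 3) ℂ} (hirr : Irreducible Q)
    (hQ : Q.IsHomogeneous 2) : IsSmoothForm Q := by
  intro v hv h
  obtain ⟨B, hB⟩ := hQ.exists_polar
  have key : ∀ w, eval v Q = 0 ∧ B v w = 0 := by
    intro w
    have h1 := X_sub_C_pow_dvd_aeval (x := 0) (v := v)
      (g := fun i => Polynomial.C (v i) + Polynomial.X * Polynomial.C (w i)) (by simp) h
    have h2 : aeval (fun i => Polynomial.C (v i) + Polynomial.X * Polynomial.C (w i)) Q =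
        Polynomial.C (eval v Q) + Polynomial.C (B v w) * Polynomial.X +
          Polynomial.C (eval w Q) * Polynomial.X ^ 2 := by
      refine Polynomial.funext fun x => ?_
      rw [eval_aeval_polynomial]
      have hvw : (fun i => (Polynomial.C (v i) + Polynomial.X * Polynomial.C (w i) :
          Polynomial ℂ).eval x) = (1 : ℂ) • v + x • w := by
        ext i
        simp
        ring
      rw [hvw, hB]
      simp
      ring
    rw [h2, map_zero, sub_zero, Polynomial.X_pow_dvd_iff] at h1
    have h3 := h1 0 two_pos
    have h4 := h1 1 one_lt_two
    constructor
    · simpa using h3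
    · simpa [Polynomial.coeff_C, Polynomial.coeff_X_pow] using h4
  obtain ⟨b, hb⟩ := exists_dotProduct_ne_zero (κ := Unit) (q := fun _ => v) fun _ => hv
  have hb0 : b ≠ 0 := by
    rintro rfl
    simp at hb
  obtain ⟨w, hw0, hbw, hw⟩ := exists_zero_on_line hQ hb0
  obtain ⟨c, rfl⟩ := exists_eq_smul_of_cross_eq_zero hv
    (cross_eq_zero_of_polar_eq_zero hirr hQ hB (key w).1 hw (key w).2)
  rw [dotProduct_smul, smul_eq_mul, mul_eq_zero, or_iff_left (hb ())] at hbw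
  exact hw0 (by rw [hbw, zero_smul])

/-- Bézout's inequality for an irreducible conic. -/
theorem sum_order_le_of_irreducible {Q : MvPolynomial (Fin 3) ℂ} (hirr : Irreducible Q)
    (hQ : Q.IsHomogeneous 2) {κ : Type*} [Fintype κ]
    {F : MvPolynomial (Fin 3) ℂ} {d : ℕ} (hF : F.IsHomogeneous d) {p : κ → Plane}
    (hp : Function.Injective p) (hpQ : ∀ k, MemLine Q (p k)) {μ : κ → ℕ}
    (hμ : ∀ k, HasOrderAt (μ k) F (p k)) (hQF : ¬ Q ∣ F) : ∑ k, μ k ≤ 2 * d := by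
  obtain _ | ⟨⟨k₀⟩⟩ := isEmpty_or_nonempty κ
  · simp
  obtain ⟨B, hB⟩ := hQ.exists_polar
  obtain ⟨L, hL, hLp⟩ := exists_line_avoiding p
  obtain ⟨a, ha, rfl⟩ := hL.exists_eq_linForm
  obtain ⟨o, ho0, hao, ho⟩ := exists_zero_on_line hQ ha
  have hpo : ∀ k, p k ≠ .mk ℂ o ho0 := by
    intro k hk
    apply hLp k
    rw [hk, memLine_mk_iff hL.2, eval_linForm, hao]
  obtain ⟨M, hM, hMo, hMp⟩ := exists_line_through_avoiding _ hpo
  obtain ⟨b, hb0, rfl⟩ := hM.exists_eq_linForm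
  rw [memLine_mk_iff hM.2, eval_linForm] at hMo
  have hb : ∀ k, b ⬝ᵥ (p k).rep ≠ 0 := fun k => by
    rw [Ne, ← memLine_linForm]
    exact hMp k
  simp only [memLine_iff_rep hQ] at hpQ
  obtain ⟨w₁, hbw₁⟩ : ∃ w₁, b ⬝ᵥ w₁ = 1 :=
    ⟨(b ⬝ᵥ (p k₀).rep)⁻¹ • (p k₀).rep,
      by rw [dotProduct_smul, smul_eq_mul, inv_mul_cancel₀ (hb k₀)]⟩
  obtain ⟨w₂, hbw₂, how₂⟩ : ∃ w₂, b ⬝ᵥ w₂ = 0 ∧ crossProduct o w₂ ≠ 0 := by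
    by_contra! hall
    obtain ⟨c, hc⟩ := exists_dotProduct_ne_zero (κ := Unit) (q := fun _ => o) fun _ => ho0
    have h1 := hall (crossProduct b c) (dot_self_cross b c)
    apply hb0
    have h2 : crossProduct o (crossProduct b c) = (c ⬝ᵥ o) • b - (b ⬝ᵥ o) • c := by
      ext i
      fin_cases i <;> simp [cross_apply, dotProduct, Fin.sum_univ_three] <;> ring
    rw [h2, hMo, zero_smul, sub_zero] at h1
    exact (smul_eq_zero.1 h1).resolve_left (hc ())
  let W : Fin 3 → Polynomial ℂ := fun i => Polynomial.C (w₁ i) + Polynomial.C (w₂ i) * Polynomial.X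
  let q : Polynomial ℂ := Polynomial.C (eval w₁ Q) + Polynomial.C (B w₁ w₂) * Polynomial.X +
    Polynomial.C (eval w₂ Q) * Polynomial.X ^ 2
  let r : Polynomial ℂ := Polynomial.C (B o w₁) + Polynomial.C (B o w₂) * Polynomial.X
  let g : Fin 3 → Polynomial ℂ := fun i => r * W i - q * Polynomial.C (o i)
  have hgx : ∀ x, (fun i => (g i).eval x) =
      B o (w₁ + x • w₂) • (w₁ + x • w₂) - eval (w₁ + x • w₂) Q • o := by
    intro x
    have h1 := hB 1 x w₁ w₂
    rw [one_smul] at h1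
    ext i
    simp [h1, g, q, r, W]
    ring
  have hparam : ∀ v, eval v Q = 0 → b ⬝ᵥ v ≠ 0 → ∃ c x : ℂ, v = c • fun i => (g i).eval x := by
    intro v hv hbv
    obtain ⟨α, γ, hαγ⟩ := exists_eq_smul_add_smul (v := v - (b ⬝ᵥ v) • w₁) hb0 hMo hbw₂
      (by simp [dotProduct_sub, dotProduct_smul, hbw₁]) how₂
    set β := b ⬝ᵥ v with hβ
    have hvw : v = α • o + β • (w₁ + (γ / β) • w₂) := by
      rw [sub_eq_iff_eq_add] at hαγ
      rw [hαγ, smul_add, smul_smul, mul_div_cancel₀ _ hbv]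
      abel
    set w := w₁ + (γ / β) • w₂ with hw
    have hbw : b ⬝ᵥ w = 1 := by
      rw [hw, dotProduct_add, dotProduct_smul, hbw₁, hbw₂, smul_zero, add_zero]
    have hQv : α * B o w + β * eval w Q = 0 := by
      have h1 := hB α β o w
      rw [← hvw, hv, ho] at h1
      refine (mul_eq_zero.1 (?_ : β * _ = 0)).resolve_left hbv
      linear_combination -h1
    have hBow : B o w ≠ 0 := by
      intro h0
      rw [h0, mul_zero, zero_add, mul_eq_zero, or_iff_right hbv] at hQv
      obtain ⟨c, hc⟩ := exists_eq_smul_of_cross_eq_zero ho0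
        (cross_eq_zero_of_polar_eq_zero hirr hQ hB ho hQv h0)
      rw [hc, dotProduct_smul, hMo, smul_zero] at hbw
      exact zero_ne_one hbw
    refine ⟨β / B o w, γ / β, ?_⟩
    rw [hgx, ← hw]
    ext i
    rw [hvw]
    simp only [Pi.add_apply, Pi.smul_apply, Pi.sub_apply, smul_eq_mul]
    field_simp
    linear_combination o i * hQv
  have hx : ∀ k, ∃ x : ℂ, ∃ (hv : (fun i => (g i).eval x) ≠ 0),
      Projectivization.mk ℂ _ hv = p k := by
    intro k
    obtain ⟨c, x, hx⟩ := hparam _ (hpQ k) (hb k)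
    have hv : (fun i => (g i).eval x) ≠ 0 := by
      intro h0
      rw [h0, smul_zero] at hx
      exact (p k).rep_nonzero hx
    refine ⟨x, hv, ?_⟩
    conv_rhs => rw [← (p k).mk_rep]
    exact ((Projectivization.mk_eq_mk_iff' ℂ _ _ (p k).rep_nonzero hv).2 ⟨_, hx.symm⟩).symm
  choose x hx using hx
  have hdeg : ∀ i, (g i).natDegree ≤ 2 := by
    intro i
    simp only [g, q, r, W]
    compute_degree
  refine sum_order_le_of_param hF hdeg hp hx hμ fun h0 => hQF ?_
  refine dvd_of_aeval_param_eq_zero (M := linForm b) hirr (fun hdvd => ?_)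
    (fun v hv hMv => hparam v hv (by simpa using hMv)) hF h0
  obtain ⟨G, hG⟩ := hdvd
  have h1 := isHomogeneous_linForm b
  rw [hG] at h1
  have := (hQ.of_mul_left_of_isHomogeneous hirr.ne_zero (by
    rintro rfl
    exact linForm_ne_zero hb0 (by simpa using hG)) h1).1
  omega

theorem exists_mul_lines_of_not_irreducible {Q : MvPolynomial (Fin 3) ℂ} (hQ0 : Q ≠ 0)
    (hQ : Q.IsHomogeneous 2) (hirr : ¬ Irreducible Q) :
    ∃ L M, IsLine L ∧ IsLine M ∧ Q = L * M := by
  have hdeg := hQ.totalDegree hQ0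
  have hu : ∀ f : MvPolynomial (Fin 3) ℂ, f ≠ 0 → f.totalDegree = 0 → IsUnit f := by
    intro f hf0 hf
    rw [totalDegree_eq_zero_iff_eq_C] at hf
    rw [hf]
    refine (isUnit_iff_ne_zero.2 fun h0 => hf0 ?_).map C
    rw [hf, h0, C_0]
  rw [irreducible_iff] at hirr
  push Not at hirr
  obtain ⟨f, g, hfg, hf, hg⟩ := hirr fun h => by
    have := (isUnit_iff_totalDegree_of_isReduced.1 h).2
    omega
  have hf0 : f ≠ 0 := fun h => hQ0 (by rw [hfg, h, zero_mul])
  have hg0 : g ≠ 0 := fun h => hQ0 (by rw [hfg, h, mul_zero])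
  have hsum : f.totalDegree + g.totalDegree = 2 := by
    rw [← totalDegree_mul_of_isDomain hf0 hg0, ← hfg, hdeg]
  have hf1 : f.totalDegree ≠ 0 := fun h => hf (hu f hf0 h)
  have hg1 : g.totalDegree ≠ 0 := fun h => hg (hu g hg0 h)
  have hdec : ∀ f : MvPolynomial (Fin 3) ℂ, f.totalDegree = 1 →
      f = homogeneousComponent 0 f + homogeneousComponent 1 f := by
    intro f hf
    conv_lhs => rw [← sum_homogeneousComponent f, hf]
    simp [Finset.sum_range_succ]
  have hf2 := hdec f (by omega)
  have hg2 := hdec g (by omega)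
  set f₀ := homogeneousComponent 0 f
  set g₀ := homogeneousComponent 0 g
  set f₁ := homogeneousComponent 1 f
  set g₁ := homogeneousComponent 1 g
  have hf₀ : f₀.IsHomogeneous 0 := homogeneousComponent_isHomogeneous 0 f
  have hg₀ : g₀.IsHomogeneous 0 := homogeneousComponent_isHomogeneous 0 g
  have hf₁ : f₁.IsHomogeneous 1 := homogeneousComponent_isHomogeneous 1 f
  have hg₁ : g₁.IsHomogeneous 1 := homogeneousComponent_isHomogeneous 1 g
  have hcomp : Q = f₁ * g₁ := by
    have h1 := homogeneousComponent_of_mem (m := 2) ((mem_homogeneousSubmodule 2 Q).2 hQ)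
    rw [if_pos rfl, hfg, hf2, hg2,
      show (f₀ + f₁) * (g₀ + g₁) = f₀ * g₀ + (f₀ * g₁ + f₁ * g₀) + f₁ * g₁ by ring,
      map_add, map_add, homogeneousComponent_of_mem
        ((mem_homogeneousSubmodule 0 _).2 (by simpa using hf₀.mul hg₀)),
      homogeneousComponent_of_mem ((mem_homogeneousSubmodule 1 _).2
        ((by simpa using hf₀.mul hg₁ : (f₀ * g₁).IsHomogeneous 1).add
          (by simpa using hf₁.mul hg₀ : (f₁ * g₀).IsHomogeneous 1))),
      homogeneousComponent_of_mem ((mem_homogeneousSubmodule 2 _).2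
        (by simpa using hf₁.mul hg₁))] at h1
    simp at h1
    rw [hfg, hf2, hg2, show (f₀ + f₁) * (g₀ + g₁) =
      f₀ * g₀ + (f₀ * g₁ + f₁ * g₀) + f₁ * g₁ by ring]
    linear_combination h1
  refine ⟨f₁, g₁, ⟨fun h => hQ0 (by rw [hcomp, h, zero_mul]), hf₁⟩,
    ⟨fun h => hQ0 (by rw [hcomp, h, mul_zero]), hg₁⟩, hcomp⟩

/-- There is a conic through any five points. -/
theorem exists_quadratic_through (p : Fin 5 → Plane) :
    ∃ Q : MvPolynomial (Fin 3) ℂ, Q ≠ 0 ∧ Q.IsHomogeneous 2 ∧ ∀ k, MemLine Q (p k) := by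
  let A : Matrix (Fin 5) (Fin 6) ℂ := fun k => ![(p k).rep 0 * (p k).rep 0,
    (p k).rep 1 * (p k).rep 1, (p k).rep 2 * (p k).rep 2, (p k).rep 0 * (p k).rep 1,
    (p k).rep 0 * (p k).rep 2, (p k).rep 1 * (p k).rep 2]
  have hker : LinearMap.ker A.mulVecLin ≠ ⊥ :=
    LinearMap.ker_ne_bot_of_finrank_lt (by simp)
  obtain ⟨c, hc, hc0⟩ := Submodule.exists_mem_ne_zero_of_ne_bot hker
  let Q : MvPolynomial (Fin 3) ℂ := C (c 0) * (X 0 * X 0) + C (c 1) * (X 1 * X 1) +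
    C (c 2) * (X 2 * X 2) + C (c 3) * (X 0 * X 1) + C (c 4) * (X 0 * X 2) +
    C (c 5) * (X 1 * X 2)
  have hQ : Q.IsHomogeneous 2 := by
    have h : ∀ (a : ℂ) (i j : Fin 3),
        (C a * (X i * X j) : MvPolynomial (Fin 3) ℂ).IsHomogeneous 2 := fun a i j => by
      simpa using (isHomogeneous_C (Fin 3) a).mul ((isHomogeneous_X ℂ i).mul (isHomogeneous_X ℂ j))
    exact (((((h _ _ _).add (h _ _ _)).add (h _ _ _)).add (h _ _ _)).add (h _ _ _)).add (h _ _ _)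
  have heval : ∀ v, eval v Q = c 0 * (v 0 * v 0) + c 1 * (v 1 * v 1) +
      c 2 * (v 2 * v 2) + c 3 * (v 0 * v 1) + c 4 * (v 0 * v 2) + c 5 * (v 1 * v 2) := by
    intro v
    simp [Q]
  refine ⟨Q, fun h0 => hc0 ?_, hQ, fun k => ?_⟩
  · have h : ∀ v, eval v Q = 0 := fun v => by rw [h0, map_zero]
    simp only [heval] at h
    have e0 := h ![1, 0, 0]
    have e1 := h ![0, 1, 0]
    have e2 := h ![0, 0, 1]
    have e3 := h ![1, 1, 0]
    have e4 := h ![1, 0, 1]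
    have e5 := h ![0, 1, 1]
    simp at e0 e1 e2 e3 e4 e5
    ext i
    fin_cases i <;> simp_all
  · rw [memLine_iff_rep hQ, heval]
    have : (A.mulVec c) k = 0 := congrFun (LinearMap.mem_ker.1 hc) k
    simp [Matrix.mulVec, dotProduct, Fin.sum_univ_succ, A] at this
    linear_combination this

open Classical in
/-- The total weight of the points lying on the curve `C`. -/
noncomputable def weightOn {ι : Type*} [Fintype ι] (p : ι → Plane) (n : ι → ℕ)
    (C : MvPolynomial (Fin 3) ℂ) : ℕ :=
  ∑ i, if MemLine C (p i) then n i else 0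

/-- A weighted bound on degrees follows from a purely combinatorial one, which may use Bézout's
inequality for all lines and irreducible conics that do not carry too much weight. -/
theorem sum_weight_mul_le {ι : Type*} [Fintype ι] {p : ι → Plane} (hp : Function.Injective p)
    (n : ι → ℕ) (t : ℕ)
    (H : ∀ (d : ℕ) (μ : ι → ℕ),
      (∀ L, IsLine L → weightOn p n L ≤ t → ∀ S : Finset ι, (∀ i ∈ S, MemLine L (p i)) →
        ∑ i ∈ S, μ i ≤ d) →
      (∀ Q : MvPolynomial (Fin 3) ℂ, Irreducible Q → Q.IsHomogeneous 2 →
        weightOn p n Q ≤ t * 2 → ∀ S : Finset ι, (∀ i ∈ S, MemLine Q (p i)) →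
        ∑ i ∈ S, μ i ≤ 2 * d) →
      ∑ i, n i * μ i ≤ t * d)
    {F : MvPolynomial (Fin 3) ℂ} {d m : ℕ} (hF0 : F ≠ 0) (hF : F.IsHomogeneous d)
    (hm : ∀ i, HasOrderAt m F (p i)) : (∑ i, n i) * m ≤ t * d := by
  rw [Finset.sum_mul]
  refine sum_weight_mul_order_le p n t (fun F d μ hF0 hF hμ hdiv => ?_) F d (fun _ => m) hF0 hF hm
  refine H d μ (fun L hL hw S hS => ?_) (fun Q hQ hQ2 hw S hS => ?_)
  · rw [← Finset.sum_coe_sort]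
    exact hL.sum_order_le hF (p := fun i : S => p i)
      (hp.comp Subtype.val_injective) (fun i => hS i i.2) (fun i => hμ i)
      (hdiv L 1 hL.2 one_pos hL.isSmoothForm (by rwa [mul_one]))
  · rw [← Finset.sum_coe_sort]
    exact sum_order_le_of_irreducible hQ hQ2 hF (p := fun i : S => p i)
      (hp.comp Subtype.val_injective) (fun i => hS i i.2) (fun i => hμ i)
      (hdiv Q 2 hQ2 two_pos (isSmoothForm_of_irreducible hQ hQ2) hw)

section

variable {α β : Type*} [Fintype α] [Fintype β]

theorem weightOn_sumElim (p : α → Plane) (q : β → Plane) (n : α → ℕ) (k : β → ℕ)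
    (C : MvPolynomial (Fin 3) ℂ) :
    weightOn (Sum.elim p q) (Sum.elim n k) C = weightOn p n C + weightOn q k C := by
  simp only [weightOn, Fintype.sum_sum_type, Sum.elim_inl, Sum.elim_inr]
  rfl

theorem weightOn_eq_zero {p : α → Plane} {n : α → ℕ} {C : MvPolynomial (Fin 3) ℂ}
    (h : ∀ i, ¬ MemLine C (p i)) : weightOn p n C = 0 := by
  simp [weightOn, h]

theorem weightOn_le_sum (p : α → Plane) (n : α → ℕ) (C : MvPolynomial (Fin 3) ℂ) :
    weightOn p n C ≤ ∑ i, n i :=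
  Finset.sum_le_sum fun i _ => by split_ifs <;> simp

open Classical in
theorem weightOn_const (p : α → Plane) (c : ℕ) (C : MvPolynomial (Fin 3) ℂ) :
    weightOn p (fun _ => c) C = (Finset.univ.filter fun i => MemLine C (p i)).card * c := by
  simp [weightOn, Finset.sum_ite]

theorem weightOn_const_le_one {p : α → Plane} (c : ℕ) {C : MvPolynomial (Fin 3) ℂ}
    (h : ∀ i j, MemLine C (p i) → MemLine C (p j) → i = j) : weightOn p (fun _ => c) C ≤ c := by
  classical
  rw [weightOn_const]
  refine (Nat.mul_le_mul_right c (?_ : _ ≤ 1)).trans_eq (one_mul c)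
  rw [Finset.card_le_one]
  intro i hi j hj
  simp only [Finset.mem_filter, Finset.mem_univ, true_and] at hi hj
  exact h i j hi hj

theorem weightOn_const_le_two {p : α → Plane} (c : ℕ) {C : MvPolynomial (Fin 3) ℂ}
    (h : ∀ i j k, MemLine C (p i) → MemLine C (p j) → MemLine C (p k) → i = j ∨ i = k ∨ j = k) :
    weightOn p (fun _ => c) C ≤ 2 * c := by
  classical
  rw [weightOn_const]
  refine Nat.mul_le_mul_right c ?_
  by_contra! h2
  obtain ⟨i, hi, j, hj, k, hk, hij, hik, hjk⟩ := Finset.two_lt_card.1 h2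
  simp only [Finset.mem_filter, Finset.mem_univ, true_and] at hi hj hk
  rcases h i j k hi hj hk with h | h | h <;> contradiction

end

theorem MemLine.ne {L : MvPolynomial (Fin 3) ℂ} {P Q : Plane} (hP : MemLine L P)
    (hQ : ¬ MemLine L Q) : P ≠ Q :=
  fun h => hQ (h ▸ hP)

/-- Two different lines have at most one common point. -/
theorem IsLine.eq_of_memLine {L M : MvPolynomial (Fin 3) ℂ} (hL : IsLine L) (hM : IsLine M)
    {P : Plane} (hP : MemLine L P) (hP' : ¬ MemLine M P) {x y : Plane} (hx : MemLine L x)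
    (hx' : MemLine M x) (hy : MemLine L y) (hy' : MemLine M y) : x = y := by
  by_contra hne
  exact hP' ((hL.memLine_iff_of_two_points hM hne hx hy hx' hy' P).1 hP)

section

variable {F ℓ : MvPolynomial (Fin 3) ℂ} {d m : ℕ}

theorem five_mul_le_of_two_triples {k n : MvPolynomial (Fin 3) ℂ}
    (hℓ : IsLine ℓ) (hk : IsLine k) (hn : IsLine n) {q r : Fin 3 → Plane} {b : Fin 2 → Plane}
    (hq : Function.Injective q) (hr : Function.Injective r) (hb : Function.Injective b)
    (hℓq : ∀ i, MemLine ℓ (q i)) (hℓr : ∀ i, ¬ MemLine ℓ (r i)) (hℓb : ∀ i, ¬ MemLine ℓ (b i))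
    (hkq : ∀ i, ¬ MemLine k (q i)) (hkr : ∀ i, MemLine k (r i)) (hkb : ∀ i, ¬ MemLine k (b i))
    (hnb : ∀ i, MemLine n (b i)) (hnq₁ : ¬ MemLine n (q 1)) (hnq₂ : ¬ MemLine n (q 2))
    (hnr₁ : ¬ MemLine n (r 1)) (hnr₂ : ¬ MemLine n (r 2))
    (hF0 : F ≠ 0) (hF : F.IsHomogeneous d) (hFq : ∀ i, HasOrderAt m F (q i))
    (hFr : ∀ i, HasOrderAt m F (r i)) (hFb : ∀ i, HasOrderAt m F (b i)) : 5 * m ≤ 2 * d := by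
  have key := sum_weight_mul_le (p := Sum.elim q (Sum.elim r b))
    (hq.sumElim (hr.sumElim hb fun i j => (hkr i).ne (hkb j)) (by
      rintro i (j | j)
      exacts [(hℓq i).ne (hℓr j), (hℓq i).ne (hℓb j)]))
    (Sum.elim ![2, 3, 3] (Sum.elim ![2, 3, 3] fun _ => 2)) 8 (fun d μ hline _ => ?_) hF0 hF
    (by rintro (i | i | i); exacts [hFq i, hFr i, hFb i])
  · simp [Fintype.sum_sum_type, Fin.sum_univ_three] at key
    omega
  · simp only [weightOn_sumElim] at hline
    have h1 := hline ℓ hℓ (by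
      rw [weightOn_eq_zero hℓr, weightOn_eq_zero hℓb, add_zero, add_zero]
      exact weightOn_le_sum _ _ _) (Finset.univ.map ⟨Sum.inl, Sum.inl_injective⟩) (by simpa)
    have h2 := hline k hk (by
      rw [weightOn_eq_zero hkq, weightOn_eq_zero hkb, add_zero, zero_add]
      exact weightOn_le_sum _ _ _)
      (Finset.univ.map ⟨Sum.inr ∘ Sum.inl, Sum.inr_injective.comp Sum.inl_injective⟩) (by simpa)
    have h3 := hline n hn (by
      have hwq : weightOn q ![2, 3, 3] n ≤ 2 := by
        simp only [weightOn, Fin.sum_univ_three, hnq₁, hnq₂]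
        simp
        split_ifs <;> simp
      have hwr : weightOn r ![2, 3, 3] n ≤ 2 := by
        simp only [weightOn, Fin.sum_univ_three, hnr₁, hnr₂]
        simp
        split_ifs <;> simp
      have hwb := weightOn_le_sum b (fun _ => 2) n
      simp at hwb
      omega)
      (Finset.univ.map ⟨Sum.inr ∘ Sum.inr, Sum.inr_injective.comp Sum.inr_injective⟩)
      (by simp [hnb])
    simp [Fin.sum_univ_three] at h1 h2 h3
    simp [Fintype.sum_sum_type, Fin.sum_univ_three]
    omega

theorem five_mul_le_of_quadruple_of_triple {k n : MvPolynomial (Fin 3) ℂ}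
    (hℓ : IsLine ℓ) (hk : IsLine k) (hn : IsLine n) {q r : Fin 3 → Plane} {R B : Plane}
    (hq : Function.Injective q) (hr : Function.Injective r) (hRq : ∀ i, q i ≠ R)
    (hℓq : ∀ i, MemLine ℓ (q i)) (hℓr : ∀ i, ¬ MemLine ℓ (r i)) (hℓB : ¬ MemLine ℓ B)
    (hℓR : MemLine ℓ R) (hkR : ¬ MemLine k R)
    (hkq : ∀ i, ¬ MemLine k (q i)) (hkr : ∀ i, MemLine k (r i)) (hkB : ¬ MemLine k B)
    (hnB : MemLine n B) (hnR : MemLine n R) (hnr : ∀ i, ¬ MemLine n (r i))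
    (hF0 : F ≠ 0) (hF : F.IsHomogeneous d) (hFq : ∀ i, HasOrderAt m F (q i))
    (hFr : ∀ i, HasOrderAt m F (r i)) (hFB : HasOrderAt m F B) (hFR : HasOrderAt m F R) :
    5 * m ≤ 2 * d := by
  have hBR : B ≠ R := fun h => hℓB (h ▸ hℓR)
  have key := sum_weight_mul_le (p := Sum.elim q (Sum.elim r ![B, R]))
    (hq.sumElim (hr.sumElim (by simpa [Function.Injective, Fin.forall_fin_two, hBR] using hBR.symm)
      fun i j => by
        fin_cases j
        exacts [(hkr i).ne hkB, (hkr i).ne hkR]) (by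
      rintro i (j | j)
      · exact (hℓq i).ne (hℓr j)
      · fin_cases j
        exacts [(hℓq i).ne hℓB, hRq i]))
    (Sum.elim (fun _ => 1) (Sum.elim (fun _ => 2) fun _ => 3)) 6 (fun d μ hline _ => ?_) hF0 hF
    (by
      rintro (i | i | i)
      exacts [hFq i, hFr i, by fin_cases i; exacts [hFB, hFR]])
  · simp [Fintype.sum_sum_type] at key
    omega
  · simp only [weightOn_sumElim] at hline
    have h1 := hline ℓ hℓ (by
      have h1 := weightOn_le_sum q (fun _ => 1) ℓ
      have h2 : weightOn ![B, R] (fun _ => 3) ℓ ≤ 3 := by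
        simp [weightOn, hℓB, hℓR]
      rw [weightOn_eq_zero hℓr]
      simp at h1
      omega) {Sum.inl 0, Sum.inl 1, Sum.inl 2, Sum.inr (Sum.inr 1)} (by simp [hℓq, hℓR])
    have h2 := hline k hk (by
      have h1 := weightOn_le_sum r (fun _ => 2) k
      have h2 : weightOn ![B, R] (fun _ => 3) k = 0 := by
        simp [weightOn, hkB, hkR]
      rw [weightOn_eq_zero hkq, h2]
      simpa using h1)
      (Finset.univ.map ⟨Sum.inr ∘ Sum.inl, Sum.inr_injective.comp Sum.inl_injective⟩) (by simpa)
    have h3 := hline n hn (by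
      have h1 := weightOn_le_sum ![B, R] (fun _ => 3) n
      have h2 : weightOn q (fun _ => 1) n = 0 := weightOn_eq_zero fun i hi =>
        hRq i (hn.eq_of_memLine hℓ hnB hℓB hi (hℓq i) hnR hℓR)
      rw [weightOn_eq_zero hnr, h2]
      simpa using h1) {Sum.inr (Sum.inr 0), Sum.inr (Sum.inr 1)} (by simp [hnB, hnR])
    simp [Fin.sum_univ_three] at h1 h2 h3
    simp [Fintype.sum_sum_type, Fin.sum_univ_three]
    omega

end

/-- No three of the points of the family `w` are collinear. -/
def NoThreeCollinear {κ : Type*} (w : κ → Plane) : Prop :=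
  ∀ L, IsLine L → ∀ i j k, MemLine L (w i) → MemLine L (w j) → MemLine L (w k) →
    i = j ∨ i = k ∨ j = k

section

variable {F ℓ : MvPolynomial (Fin 3) ℂ} {d m : ℕ}

/-- A weighted bound for points `q` on a line and points `w` in general position off it, with
constant weights `a` and `c`, using the line and the lines through two of the points `w`. -/
theorem card_mul_add_card_mul_le {κ ν : Type*} [Fintype κ] [Fintype ν] (hℓ : IsLine ℓ)
    {q : κ → Plane} {w : ν → Plane} (hq : Function.Injective q) (hw : Function.Injective w)
    (hℓq : ∀ i, MemLine ℓ (q i)) (hℓw : ∀ i, ¬ MemLine ℓ (w i)) (hw3 : NoThreeCollinear w)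
    (n : κ → ℕ) (c t s : ℕ) (hnt : ∑ i, n i ≤ t) (hst : s + 2 * c ≤ t)
    (hs : ∀ L, IsLine L → ∀ i j, i ≠ j → MemLine L (w i) → MemLine L (w j) →
      weightOn q n L ≤ s)
    (H : ∀ (d : ℕ) (μ : κ → ℕ) (ν : ν → ℕ), ∑ i, μ i ≤ d →
      (∀ i j, i ≠ j → ν i + ν j ≤ d) →
      (∀ L, IsLine L → ∀ i j, i ≠ j → MemLine L (w i) → MemLine L (w j) →
        ∀ k, MemLine L (q k) → μ k + ν i + ν j ≤ d) →
      ∑ i, n i * μ i + c * ∑ i, ν i ≤ t * d)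
    (hF0 : F ≠ 0) (hF : F.IsHomogeneous d) (hFq : ∀ i, HasOrderAt m F (q i))
    (hFw : ∀ i, HasOrderAt m F (w i)) :
    (∑ i, n i + Fintype.card ν * c) * m ≤ t * d := by
  classical
  have key := sum_weight_mul_le (p := Sum.elim q w)
    (hq.sumElim hw fun i j => (hℓq i).ne (hℓw j))
    (Sum.elim n (fun _ => c)) t (fun d μ hline _ => ?_) hF0 hF
    (by rintro (i | i); exacts [hFq i, hFw i])
  · simpa [Fintype.sum_sum_type] using key
  · simp only [weightOn_sumElim] at hline
    have hweight : ∀ L, IsLine L → ∀ i j, i ≠ j → MemLine L (w i) → MemLine L (w j) →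
        weightOn q n L + weightOn w (fun _ => c) L ≤ t := fun L hL i j hij hi hj =>
      (add_le_add (hs L hL i j hij hi hj) (weightOn_const_le_two c (hw3 L hL))).trans hst
    have h := H d (fun i => μ (Sum.inl i)) (fun i => μ (Sum.inr i)) ?_ ?_ ?_
    · simpa [Fintype.sum_sum_type, Finset.mul_sum] using h
    · have h1 := hline ℓ hℓ (by
        rw [weightOn_eq_zero hℓw, add_zero]
        exact (weightOn_le_sum _ _ _).trans hnt)
        (Finset.univ.map ⟨Sum.inl, Sum.inl_injective⟩) (by simpa)
      simpa using h1
    · intro i j hij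
      obtain ⟨L, hL, hi, hj⟩ := exists_line_through (w i) (w j)
      have h1 := hline L hL (hweight L hL i j hij hi hj) {Sum.inr i, Sum.inr j} (by simp [hi, hj])
      rwa [Finset.sum_pair (by simpa using hij)] at h1
    · intro L hL i j hij hi hj k hk
      have h1 := hline L hL (hweight L hL i j hij hi hj) {Sum.inl k, Sum.inr i, Sum.inr j}
        (by simp [hi, hj, hk])
      rw [Finset.sum_insert (by simp), Finset.sum_pair (by simpa using hij)] at h1
      omega

theorem weightOn_const_le_of_transversal {κ : Type*} [Fintype κ] (hℓ : IsLine ℓ)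
    {q : κ → Plane} (hq : Function.Injective q) (hℓq : ∀ i, MemLine ℓ (q i))
    {L : MvPolynomial (Fin 3) ℂ} (hL : IsLine L) {P : Plane} (hP : MemLine L P)
    (hℓP : ¬ MemLine ℓ P) (c : ℕ) : weightOn q (fun _ => c) L ≤ c :=
  weightOn_const_le_one c fun i j hi hj =>
    hq (hL.eq_of_memLine hℓ hP hℓP hi (hℓq i) hj (hℓq j))

theorem five_mul_le_of_pentagon (hℓ : IsLine ℓ)
    {q : Fin 4 → Plane} {w : Fin 5 → Plane} (hq : Function.Injective q) (hw : Function.Injective w)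
    (hℓq : ∀ i, MemLine ℓ (q i)) (hℓw : ∀ i, ¬ MemLine ℓ (w i)) (hw3 : NoThreeCollinear w)
    (hF0 : F ≠ 0) (hF : F.IsHomogeneous d) (hFq : ∀ i, HasOrderAt m F (q i))
    (hFw : ∀ i, HasOrderAt m F (w i)) : 5 * m ≤ 2 * d := by
  have key := card_mul_add_card_mul_le hℓ hq hw hℓq hℓw hw3 (fun _ => 5) 6 20 5 (by simp)
    (by simp) (fun L hL i j _ hi _ =>
      weightOn_const_le_of_transversal hℓ hq hℓq hL hi (hℓw i) 5)
    (fun d μ ν h1 h2 _ => ?_) hF0 hF hFq hFw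
  · simp at key
    omega
  · have h01 := h2 0 1 (by decide)
    have h12 := h2 1 2 (by decide)
    have h23 := h2 2 3 (by decide)
    have h34 := h2 3 4 (by decide)
    have h40 := h2 4 0 (by decide)
    rw [← Finset.mul_sum, Fin.sum_univ_five]
    omega

theorem five_mul_le_of_quadrangle (hℓ : IsLine ℓ)
    {q : Fin 5 → Plane} {w : Fin 4 → Plane} (hq : Function.Injective q) (hw : Function.Injective w)
    (hℓq : ∀ i, MemLine ℓ (q i)) (hℓw : ∀ i, ¬ MemLine ℓ (w i)) (hw3 : NoThreeCollinear w)
    (hF0 : F ≠ 0) (hF : F.IsHomogeneous d) (hFq : ∀ i, HasOrderAt m F (q i))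
    (hFw : ∀ i, HasOrderAt m F (w i)) : 5 * m ≤ 2 * d := by
  have key := card_mul_add_card_mul_le hℓ hq hw hℓq hℓw hw3 (fun _ => 8) 15 40 8 (by simp)
    (by simp) (fun L hL i j _ hi _ =>
      weightOn_const_le_of_transversal hℓ hq hℓq hL hi (hℓw i) 8)
    (fun d μ ν h1 h2 _ => ?_) hF0 hF hFq hFw
  · simp at key
    omega
  · have h01 := h2 0 1 (by decide)
    have h23 := h2 2 3 (by decide)
    rw [← Finset.mul_sum, Fin.sum_univ_four]
    omega

theorem five_mul_le_of_triangle (hℓ : IsLine ℓ)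
    {q : Fin 4 → Plane} {w : Fin 3 → Plane} (hq : Function.Injective q) (hw : Function.Injective w)
    (hℓq : ∀ i, MemLine ℓ (q i)) (hℓw : ∀ i, ¬ MemLine ℓ (w i)) (hw3 : NoThreeCollinear w)
    (hqw : ∀ L, IsLine L → ∀ i j, i ≠ j → MemLine L (w i) → MemLine L (w j) →
      ∀ k, ¬ MemLine L (q k))
    (hF0 : F ≠ 0) (hF : F.IsHomogeneous d) (hFq : ∀ i, HasOrderAt m F (q i))
    (hFw : ∀ i, HasOrderAt m F (w i)) : 5 * m ≤ 2 * d := by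
  have key := card_mul_add_card_mul_le hℓ hq hw hℓq hℓw hw3 (fun _ => 1) 2 4 0 (by simp)
    (by simp) (fun L hL i j hij hi hj => (weightOn_eq_zero (hqw L hL i j hij hi hj)).le)
    (fun d μ ν h1 h2 _ => ?_) hF0 hF hFq hFw
  · simp at key
    omega
  · have h01 := h2 0 1 (by decide)
    have h12 := h2 1 2 (by decide)
    have h20 := h2 2 0 (by decide)
    rw [← Finset.mul_sum, Fin.sum_univ_three]
    omega

/-- The lower bound `17 / 7` for the exceptional configuration: `D` and `Q` lie on a line `ℓ`,
the `i`-th side of the triangle `w` passes through `Q i`, and no side passes through `D`. -/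
theorem seventeen_mul_le (hℓ : IsLine ℓ) {D Q w : Fin 3 → Plane}
    (hD : Function.Injective D) (hQ : Function.Injective Q) (hDQ : ∀ i j, D i ≠ Q j)
    (hw : Function.Injective w) (hℓD : ∀ i, MemLine ℓ (D i)) (hℓQ : ∀ i, MemLine ℓ (Q i))
    (hℓw : ∀ i, ¬ MemLine ℓ (w i)) (hw3 : NoThreeCollinear w)
    (hDw : ∀ L, IsLine L → ∀ i j, i ≠ j → MemLine L (w i) → MemLine L (w j) →
      ∀ k, ¬ MemLine L (D k))
    (hQw : ∀ k, ∃ L, IsLine L ∧ MemLine L (w (k + 1)) ∧ MemLine L (w (k + 2)) ∧ MemLine L (Q k))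
    (hF0 : F ≠ 0) (hF : F.IsHomogeneous d) (hFD : ∀ i, HasOrderAt m F (D i))
    (hFQ : ∀ i, HasOrderAt m F (Q i))
    (hFw : ∀ i, HasOrderAt m F (w i)) : 17 * m ≤ 7 * d := by
  have key := card_mul_add_card_mul_le (q := Sum.elim D Q) hℓ (hD.sumElim hQ hDQ) hw
    (by rintro (i | i); exacts [hℓD i, hℓQ i]) hℓw hw3
    (Sum.elim (fun _ => 6) (fun _ => 1)) 10 21 1 (by simp [Fintype.sum_sum_type])
    (by simp) (fun L hL i j hij hi hj => ?_)
    (fun d μ ν h1 _ h2 => ?_) hF0 hF (by rintro (i | i); exacts [hFD i, hFQ i]) hFw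
  · simp [Fintype.sum_sum_type] at key
    omega
  · rw [weightOn_sumElim, weightOn_eq_zero (hDw L hL i j hij hi hj), zero_add]
    exact weightOn_const_le_of_transversal hℓ hQ hℓQ hL hi (hℓw i) 1
  · obtain ⟨L₀, hL₀, h01, h02, h0⟩ := hQw 0
    obtain ⟨L₁, hL₁, h11, h12, h1'⟩ := hQw 1
    obtain ⟨L₂, hL₂, h21, h22, h2'⟩ := hQw 2
    have e0 := h2 L₀ hL₀ _ _ (by decide) h01 h02 (Sum.inr 0) h0
    have e1 := h2 L₁ hL₁ _ _ (by decide) h11 h12 (Sum.inr 1) h1'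
    have e2 := h2 L₂ hL₂ _ _ (by decide) h21 h22 (Sum.inr 2) h2'
    simp [Fintype.sum_sum_type, Fin.sum_univ_three] at h1 e0 e1 e2 ⊢
    omega

theorem five_mul_le_of_conic {C : MvPolynomial (Fin 3) ℂ} (hirr : Irreducible C)
    (hC : C.IsHomogeneous 2) {q : Fin 8 → Plane} {P : Plane} (hq : Function.Injective q)
    (hCq : ∀ i, MemLine C (q i)) (hCP : ¬ MemLine C P)
    (hF0 : F ≠ 0) (hF : F.IsHomogeneous d) (hFq : ∀ i, HasOrderAt m F (q i))
    (hFP : HasOrderAt m F P) : 5 * m ≤ 2 * d := by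
  obtain ⟨L, hL, hLP, hLq⟩ := exists_line_through_avoiding P fun i => (hCq i).ne hCP
  have key := sum_weight_mul_le (p := Sum.elim q fun _ : Fin 1 => P)
    (hq.sumElim (Function.injective_of_subsingleton _) fun i _ => (hCq i).ne hCP)
    (Sum.elim (fun _ => 1) (fun _ => 2)) 4 (fun d μ hline hconic => ?_) hF0 hF
    (by rintro (i | i); exacts [hFq i, hFP])
  · simp [Fintype.sum_sum_type] at key
    omega
  · simp only [weightOn_sumElim] at hline hconic
    have h1 := hline L hL (by
      have := weightOn_le_sum (fun _ : Fin 1 => P) (fun _ => 2) L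
      rw [weightOn_eq_zero hLq]
      simp at this
      omega) {Sum.inr 0} (by simpa)
    have h2 := hconic C hirr hC (by
      have := weightOn_le_sum q (fun _ => 1) C
      rw [weightOn_eq_zero (p := fun _ : Fin 1 => P) fun _ => hCP]
      simpa using this) (Finset.univ.map ⟨Sum.inl, Sum.inl_injective⟩) (by simpa)
    simp [Fintype.sum_sum_type] at h1 h2 ⊢
    omega

open Classical in
theorem five_mul_le_of_nine {p : Fin 9 → Plane} (hp : Function.Injective p)
    (hlines : ∀ L, IsLine L → (Finset.univ.filter fun i => MemLine L (p i)).card ≤ 3)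
    (hconics : ∀ Q : MvPolynomial (Fin 3) ℂ, Irreducible Q → Q.IsHomogeneous 2 →
      (Finset.univ.filter fun i => MemLine Q (p i)).card ≤ 7)
    (hF0 : F ≠ 0) (hF : F.IsHomogeneous d) (hFp : ∀ i, HasOrderAt m F (p i)) :
    5 * m ≤ 2 * d := by
  have key := sum_weight_mul_le hp (fun _ => 5) 18 (fun d μ hline hconic => ?_) hF0 hF hFp
  · simp at key
    omega
  · simp only [weightOn_const] at hline hconic
    have h : ∀ i : Fin 9, μ i + μ (i + 1) + μ (i + 2) + μ (i + 3) + μ (i + 4) ≤ 2 * d := by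
      intro i
      have hsum : μ i + μ (i + 1) + μ (i + 2) + μ (i + 3) + μ (i + 4) =
          ∑ k ∈ ({i, i + 1, i + 2, i + 3, i + 4} : Finset (Fin 9)), μ k := by
        rw [Finset.sum_insert, Finset.sum_insert, Finset.sum_insert, Finset.sum_pair]
        · ring
        all_goals revert i; decide
      obtain ⟨Q, hQ0, hQ, hQp⟩ := exists_quadratic_through
        ![p i, p (i + 1), p (i + 2), p (i + 3), p (i + 4)]
      have hQp' : ∀ k ∈ ({i, i + 1, i + 2, i + 3, i + 4} : Finset (Fin 9)), MemLine Q (p k) := by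
        simpa [Fin.forall_fin_succ] using hQp
      rw [hsum]
      generalize ({i, i + 1, i + 2, i + 3, i + 4} : Finset (Fin 9)) = T at hQp' ⊢
      by_cases hirr : Irreducible Q
      · have := hconics Q hirr hQ
        exact hconic Q hirr hQ (by omega) T hQp'
      · obtain ⟨L, M, hL, hM, rfl⟩ := exists_mul_lines_of_not_irreducible hQ0 hQ hirr
        have hL3 := hlines L hL
        have hM3 := hlines M hM
        have h1 := hline L hL (by omega) (T.filter fun i => MemLine L (p i)) (by simp)
        have h2 := hline M hM (by omega) (T.filter fun i => ¬ MemLine L (p i)) (fun k hk => by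
          rw [Finset.mem_filter] at hk
          have := hQp' k hk.1
          rw [memLine_iff_rep hQ, map_mul, mul_eq_zero, ← memLine_iff_rep hL.2,
            ← memLine_iff_rep hM.2] at this
          exact this.resolve_left hk.2)
        rw [← Finset.sum_filter_add_sum_filter_not T fun i => MemLine L (p i)]
        omega
    have h0 := h 0
    have h1 := h 1
    have h2 := h 2
    have h3 := h 3
    have h4 := h 4
    have h5 := h 5
    have h6 := h 6
    have h7 := h 7
    have h8 := h 8
    simp only [Fin.reduceAdd, zero_add] at h0 h1 h2 h3 h4 h5 h6 h7 h8
    rw [← Finset.mul_sum]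
    simp only [Fin.sum_univ_succ, Fin.succ_zero_eq_one, Fin.succ_one_eq_two] at *
    simp at *
    omega

end

theorem Set.exists_injective_fin_of_le_ncard {α : Type*} {S : Set α} {k : ℕ} (h : k ≤ S.ncard) :
    ∃ f : Fin k → α, Function.Injective f ∧ ∀ i, f i ∈ S := by
  rcases Nat.eq_zero_or_pos k with rfl | hk
  · exact ⟨Fin.elim0, fun i => i.elim0, fun i => i.elim0⟩
  have hS : S.Finite := Set.finite_of_ncard_pos (hk.trans_le h)
  obtain ⟨t, ht, htk⟩ := Finset.exists_subset_card_eq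
    (h.trans_eq (Set.ncard_eq_toFinset_card S hS))
  refine ⟨fun i => (t.equivFinOfCardEq htk).symm i,
    Subtype.val_injective.comp (Equiv.injective _), fun i => ?_⟩
  exact hS.mem_toFinset.1 (ht ((t.equivFinOfCardEq htk).symm i).2)

/-- Removing from a set of points of a line the points of another line removes at most one. -/
theorem IsLine.ncard_le_ncard_diff_add_one {L M : MvPolynomial (Fin 3) ℂ} (hL : IsLine L)
    (hM : IsLine M) {P : Plane} (hP : MemLine M P) (hP' : ¬ MemLine L P) {S : Set Plane}
    (hS : S.Finite) (hSL : ∀ x ∈ S, MemLine L x) :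
    S.ncard ≤ (S \ {x | MemLine M x}).ncard + 1 := by
  have h : (S ∩ {x | MemLine M x}).ncard ≤ 1 := by
    refine (Set.ncard_le_one (hS.inter_of_left _)).2 fun x hx y hy => ?_
    exact hM.eq_of_memLine hL hP hP' hx.2 (hSL x hx.1) hy.2 (hSL y hy.1)
  have := Set.ncard_inter_add_ncard_sdiff_eq_ncard S {x | MemLine M x} hS
  omega

theorem MemLine.mul_left {C : MvPolynomial (Fin 3) ℂ} {x : Plane} (h : MemLine C x)
    (D : MvPolynomial (Fin 3) ℂ) : MemLine (C * D) x := fun v hv e => by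
  rw [map_mul, h v hv e, zero_mul]

theorem MemLine.mul_right {C : MvPolynomial (Fin 3) ℂ} {x : Plane} (h : MemLine C x)
    (D : MvPolynomial (Fin 3) ℂ) : MemLine (D * C) x := fun v hv e => by
  rw [map_mul, h v hv e, mul_zero]

theorem containedInConic_of_mem_two_lines {L M : MvPolynomial (Fin 3) ℂ} (hL : IsLine L)
    (hM : IsLine M) {Z : Set Plane} (h : ∀ x ∈ Z, MemLine L x ∨ MemLine M x) :
    ContainedInConic Z :=
  ⟨L * M, mul_ne_zero hL.1 hM.1, hL.2.mul hM.2, fun x hx =>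
    (h x hx).elim (fun hx => hx.mul_left _) (fun hx => hx.mul_right _)⟩

section

variable {F ℓ : MvPolynomial (Fin 3) ℂ} {d m : ℕ} {Z : Set Plane}

theorem five_mul_le_of_four_le_ncard_diff (hZ : Z.Finite) (hF0 : F ≠ 0)
    (hF : F.IsHomogeneous d) (hFZ : ∀ x ∈ Z, HasOrderAt m F x) {k : MvPolynomial (Fin 3) ℂ}
    (hℓ : IsLine ℓ) (hk : IsLine k)
    (hℓk : 4 ≤ ({x ∈ Z | MemLine ℓ x} \ {x | MemLine k x}).ncard)
    (hkℓ : 3 ≤ ({x ∈ Z | MemLine k x} \ {x | MemLine ℓ x}).ncard)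
    {B : Plane} (hB : B ∈ Z) (hℓB : ¬ MemLine ℓ B) (hkB : ¬ MemLine k B) : 5 * m ≤ 2 * d := by
  obtain ⟨r, hr, hrmem⟩ := Set.exists_injective_fin_of_le_ncard hkℓ
  choose n hn hnB hnr using fun i => exists_line_through B (r i)
  set A := {x ∈ Z | MemLine ℓ x} \ {x | MemLine k x} with hA
  have hAℓ : ∀ x ∈ A, MemLine ℓ x := fun x hx => hx.1.2
  have hAfin : A.Finite := (hZ.subset (Set.sep_subset _ _)).sdiff
  have h0 := hℓ.ncard_le_ncard_diff_add_one (hn 0) (hnB 0) hℓB hAfin hAℓ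
  have h1 := hℓ.ncard_le_ncard_diff_add_one (hn 1) (hnB 1) hℓB (hAfin.sdiff)
    (S := A \ {x | MemLine (n 0) x}) fun x hx => hAℓ x hx.1
  have h2 := hℓ.ncard_le_ncard_diff_add_one (hn 2) (hnB 2) hℓB hAfin.sdiff.sdiff
    (S := (A \ {x | MemLine (n 0) x}) \ {x | MemLine (n 1) x}) fun x hx => hAℓ x hx.1.1
  obtain ⟨R, ⟨⟨hRA, hR0⟩, hR1⟩, hR2⟩ := Set.nonempty_of_ncard_ne_zero
    (s := ((A \ {x | MemLine (n 0) x}) \ {x | MemLine (n 1) x}) \ {x | MemLine (n 2) x})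
    (by omega)
  have h3 := Set.ncard_sdiff_singleton_add_one hRA hAfin
  obtain ⟨q, hq, hqmem⟩ := Set.exists_injective_fin_of_le_ncard (S := A \ {R}) (k := 3) (by omega)
  obtain ⟨M, hM, hMB, hMR⟩ := exists_line_through B R
  have hBr : ∀ i, B ≠ r i := fun i h => hkB (h ▸ (hrmem i).1.2)
  have hRn : ∀ i, ¬ MemLine (n i) R := by
    intro i
    fin_cases i
    exacts [hR0, hR1, hR2]
  exact five_mul_le_of_quadruple_of_triple hℓ hk hM hq hr (fun i => (hqmem i).2)
    (fun i => hAℓ _ (hqmem i).1) (fun i => (hrmem i).2) hℓB (hAℓ R hRA) hRA.2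
    (fun i => (hqmem i).1.2) (fun i => (hrmem i).1.2) hkB hMB hMR
    (fun i h => hRn i (((hn i).memLine_iff_of_two_points hM (hBr i) (hnB i) (hnr i) hMB h R).2 hMR))
    hF0 hF (fun i => hFZ _ (hqmem i).1.1.1) (fun i => hFZ _ (hrmem i).1.1) (hFZ B hB)
    (hFZ R hRA.1.1)

theorem five_mul_le_of_three_le_ncard_diff (hZ : Z.Finite) (hF0 : F ≠ 0)
    (hF : F.IsHomogeneous d) (hFZ : ∀ x ∈ Z, HasOrderAt m F x) {k : MvPolynomial (Fin 3) ℂ}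
    (hℓ : IsLine ℓ) (hk : IsLine k)
    (hℓk : 3 ≤ ({x ∈ Z | MemLine ℓ x} \ {x | MemLine k x}).ncard)
    (hkℓ : 3 ≤ ({x ∈ Z | MemLine k x} \ {x | MemLine ℓ x}).ncard)
    (hS : 2 ≤ {x ∈ Z | ¬ MemLine ℓ x ∧ ¬ MemLine k x}.ncard) : 5 * m ≤ 2 * d := by
  obtain ⟨b, hb, hbmem⟩ := Set.exists_injective_fin_of_le_ncard hS
  obtain ⟨n, hn, hn0, hn1⟩ := exists_line_through (b 0) (b 1)
  -- a triple of points of a line missing `b 0`, the last two of which are off `n`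
  have key : ∀ {L : MvPolynomial (Fin 3) ℂ} {A : Set Plane}, IsLine L → ¬ MemLine L (b 0) →
      A.Finite → (∀ x ∈ A, MemLine L x) → 3 ≤ A.ncard →
      ∃ q : Fin 3 → Plane, Function.Injective q ∧ (∀ i, q i ∈ A) ∧ ¬ MemLine n (q 1) ∧
        ¬ MemLine n (q 2) := by
    intro L A hL hLb hA hAL hA3
    have h := hL.ncard_le_ncard_diff_add_one hn hn0 hLb hA hAL
    obtain ⟨y, hy, z, hz, hyz⟩ := (Set.one_lt_ncard (s := A \ {x | MemLine n x}) hA.sdiff).1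
      (by omega)
    have h1 := Set.ncard_sdiff_singleton_add_one hy.1 hA
    have h2 := Set.ncard_sdiff_singleton_add_one (s := A \ {y}) (a := z) ⟨hz.1, hyz.symm⟩ hA.sdiff
    obtain ⟨x, ⟨hx, hxy⟩, hxz⟩ := Set.nonempty_of_ncard_ne_zero (s := (A \ {y}) \ {z}) (by omega)
    refine ⟨![x, y, z], ?_, by simp [Fin.forall_fin_succ, hx, hy.1, hz.1], hy.2, hz.2⟩
    simp only [Set.mem_singleton_iff] at hxy hxz
    simp [Function.Injective, Fin.forall_fin_succ, hxy, hxz, hyz, Ne.symm hxy, Ne.symm hxz,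
      hyz.symm]
  have hfin : ∀ L : MvPolynomial (Fin 3) ℂ, {x ∈ Z | MemLine L x}.Finite := fun L =>
    hZ.subset (Set.sep_subset _ _)
  obtain ⟨q, hq, hqmem, hq1, hq2⟩ := key hℓ (hbmem 0).2.1 (hfin ℓ).sdiff (fun x hx => hx.1.2) hℓk
  obtain ⟨r, hr, hrmem, hr1, hr2⟩ := key hk (hbmem 0).2.2 (hfin k).sdiff (fun x hx => hx.1.2) hkℓ
  exact five_mul_le_of_two_triples hℓ hk hn hq hr hb (fun i => (hqmem i).1.2)
    (fun i => (hrmem i).2) (fun i => (hbmem i).2.1) (fun i => (hqmem i).2)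
    (fun i => (hrmem i).1.2) (fun i => (hbmem i).2.2) (by simp [Fin.forall_fin_two, hn0, hn1])
    hq1 hq2 hr1 hr2 hF0 hF (fun i => hFZ _ (hqmem i).1.1) (fun i => hFZ _ (hrmem i).1.1)
    (fun i => hFZ _ (hbmem i).1)

/-- Four points on a line, and three further points on another line. -/
theorem five_mul_le_of_four_le_of_three_le (hZ : Z.Finite) (hcard : 9 ≤ Z.ncard)
    (hconic : ¬ ContainedInConic Z) (hF0 : F ≠ 0)
    (hF : F.IsHomogeneous d) (hFZ : ∀ x ∈ Z, HasOrderAt m F x) {k : MvPolynomial (Fin 3) ℂ}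
    (hℓ : IsLine ℓ) (hk : IsLine k) (h4 : 4 ≤ {x ∈ Z | MemLine ℓ x}.ncard)
    (h3 : 3 ≤ {x ∈ Z | ¬ MemLine ℓ x ∧ MemLine k x}.ncard) : 5 * m ≤ 2 * d := by
  have hfin : ∀ p : Plane → Prop, {x ∈ Z | p x}.Finite := fun p => hZ.subset (Set.sep_subset _ _)
  have hkℓ : {x ∈ Z | MemLine k x} \ {x | MemLine ℓ x} = {x ∈ Z | ¬ MemLine ℓ x ∧ MemLine k x} := by
    ext x
    simp only [Set.mem_sdiff, Set.mem_ofPred_eq]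
    tauto
  obtain ⟨x, -, hℓx, hkx⟩ := Set.nonempty_of_ncard_ne_zero
    (s := {x ∈ Z | ¬ MemLine ℓ x ∧ MemLine k x}) (by omega)
  have h1 := hℓ.ncard_le_ncard_diff_add_one hk hkx hℓx (hfin (MemLine ℓ)) fun x hx => hx.2
  rw [← hkℓ] at h3
  by_cases hS : 2 ≤ {x ∈ Z | ¬ MemLine ℓ x ∧ ¬ MemLine k x}.ncard
  · exact five_mul_le_of_three_le_ncard_diff hZ hF0 hF hFZ hℓ hk (by omega) h3 hS
  obtain ⟨B, hB, hℓB, hkB⟩ : ∃ B ∈ Z, ¬ MemLine ℓ B ∧ ¬ MemLine k B := by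
    by_contra! h
    exact hconic (containedInConic_of_mem_two_lines hℓ hk fun x hx =>
      or_iff_not_imp_left.2 (h x hx))
  have hsplit : ∀ (S : Set Plane) (p : Plane → Prop), S.Finite →
      {x ∈ S | p x}.ncard + {x ∈ S | ¬ p x}.ncard = S.ncard := fun S p hS =>
    Set.ncard_inter_add_ncard_sdiff_eq_ncard S {x | p x} hS
  have e1 := hsplit Z (MemLine ℓ) hZ
  have e2 := hsplit {x ∈ Z | ¬ MemLine ℓ x} (MemLine k) (hfin _)
  have e3 := hsplit {x ∈ Z | MemLine ℓ x} (MemLine k) (hfin _)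
  simp only [Set.mem_ofPred_eq, and_assoc] at e2 e3
  by_cases h4' : 4 ≤ ({x ∈ Z | MemLine ℓ x} \ {x | MemLine k x}).ncard
  · exact five_mul_le_of_four_le_ncard_diff hZ hF0 hF hFZ hℓ hk h4' h3 hB hℓB hkB
  · exact five_mul_le_of_four_le_ncard_diff hZ hF0 hF hFZ hk hℓ (by rw [hkℓ] at *; omega)
      (by omega) hB hkB hℓB

end

section

variable {F ℓ : MvPolynomial (Fin 3) ℂ} {d m : ℕ} {Z : Set Plane}

open Classical in
theorem card_filter_le_ncard {k : ℕ} (hZ : Z.Finite) {p : Fin k → Plane}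
    (hp : Function.Injective p) (hpZ : ∀ i, p i ∈ Z) (C : MvPolynomial (Fin 3) ℂ) :
    (Finset.univ.filter fun i => MemLine C (p i)).card ≤ {x ∈ Z | MemLine C x}.ncard := by
  rw [← Set.ncard_coe_finset, ← Set.ncard_image_of_injective _ hp]
  refine Set.ncard_le_ncard ?_ (hZ.subset (Set.sep_subset _ _))
  rintro _ ⟨i, hi, rfl⟩
  exact ⟨hpZ i, by simpa using hi⟩

/-- No line contains four of the points. -/
theorem five_mul_le_of_forall_line_le_three (hZ : Z.Finite) (hcard : 9 ≤ Z.ncard)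
    (hconic : ¬ ContainedInConic Z) (hF0 : F ≠ 0)
    (hF : F.IsHomogeneous d) (hFZ : ∀ x ∈ Z, HasOrderAt m F x)
    (h3 : ∀ L, IsLine L → {x ∈ Z | MemLine L x}.ncard ≤ 3) : 5 * m ≤ 2 * d := by
  by_cases h8 : ∃ C : MvPolynomial (Fin 3) ℂ, Irreducible C ∧ C.IsHomogeneous 2 ∧
      8 ≤ {x ∈ Z | MemLine C x}.ncard
  · obtain ⟨C, hirr, hC, h8⟩ := h8
    obtain ⟨P, hP, hCP⟩ : ∃ P ∈ Z, ¬ MemLine C P := by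
      by_contra! h
      exact hconic ⟨C, hirr.ne_zero, hC, h⟩
    obtain ⟨q, hq, hqmem⟩ := Set.exists_injective_fin_of_le_ncard h8
    exact five_mul_le_of_conic hirr hC hq (fun i => (hqmem i).2) hCP hF0 hF
      (fun i => hFZ _ (hqmem i).1) (hFZ P hP)
  · push Not at h8
    obtain ⟨p, hp, hpZ⟩ := Set.exists_injective_fin_of_le_ncard hcard
    refine five_mul_le_of_nine hp (fun L hL => ?_) (fun C hirr hC => ?_) hF0 hF
      (fun i => hFZ _ (hpZ i))
    · exact (card_filter_le_ncard hZ hp hpZ L).trans (h3 L hL)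
    · exact (card_filter_le_ncard hZ hp hpZ C).trans (Nat.le_of_lt_succ (h8 C hirr hC))

theorem noThreeCollinear_of_ncard_le_two {κ : Type*} {S : Set Plane} (hS : S.Finite)
    (h2 : ∀ L, IsLine L → {x ∈ S | MemLine L x}.ncard ≤ 2) {w : κ → Plane}
    (hw : Function.Injective w) (hwS : ∀ i, w i ∈ S) : NoThreeCollinear w := by
  intro L hL i j k hi hj hk
  by_contra! h
  have h3 := (Set.two_lt_ncard_iff (hS.subset (Set.sep_subset S (MemLine L)))).2
    ⟨w i, w j, w k, ⟨hwS i, hi⟩, ⟨hwS j, hj⟩, ⟨hwS k, hk⟩, hw.ne h.1, hw.ne h.2.1, hw.ne h.2.2⟩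
  exact absurd (h2 L hL) (not_le.2 h3)

/-- The exceptional configuration: the points `D` and `Q` lie on the line `ℓ`, the points `w` form
a triangle whose `k`-th side meets `ℓ` in `Q k`. -/
structure IsTriangleConfig (Z : Set Plane) (ℓ : MvPolynomial (Fin 3) ℂ)
    (side : Fin 3 → MvPolynomial (Fin 3) ℂ) (D Q w : Fin 3 → Plane) : Prop where
  isLine : IsLine ℓ
  isLine_side : ∀ k, IsLine (side k)
  injective_D : Function.Injective D
  injective_Q : Function.Injective Q
  injective_w : Function.Injective w
  D_mem : ∀ i, D i ∈ Z
  Q_mem : ∀ i, Q i ∈ Z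
  w_mem : ∀ i, w i ∈ Z
  cover : ∀ x ∈ Z, (∃ i, x = D i) ∨ (∃ i, x = Q i) ∨ ∃ i, x = w i
  memLine_D : ∀ i, MemLine ℓ (D i)
  memLine_Q : ∀ i, MemLine ℓ (Q i)
  notMem_w : ∀ i, ¬ MemLine ℓ (w i)
  noThreeCollinear : NoThreeCollinear w
  side_w : ∀ i k, i ≠ k → MemLine (side k) (w i)
  side_Q : ∀ k, MemLine (side k) (Q k)
  side_D : ∀ k i, ¬ MemLine (side k) (D i)

theorem eq_side_of_two_vertices {side : Fin 3 → MvPolynomial (Fin 3) ℂ} {w : Fin 3 → Plane}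
    (hside : ∀ k, IsLine (side k)) (hw : Function.Injective w)
    (hsw : ∀ i k, i ≠ k → MemLine (side k) (w i)) {L : MvPolynomial (Fin 3) ℂ} (hL : IsLine L)
    {i j : Fin 3} (hij : i ≠ j) (hi : MemLine L (w i)) (hj : MemLine L (w j)) :
    ∃ k, ∀ x, MemLine L x ↔ MemLine (side k) x := by
  obtain ⟨k, hik, hjk⟩ : ∃ k, i ≠ k ∧ j ≠ k := by
    clear hi hj
    revert i j
    decide
  exact ⟨k, hL.memLine_iff_of_two_points (hside k) (hw.ne hij) hi hj (hsw i k hik) (hsw j k hjk)⟩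

theorem exists_isTriangleConfig (hZ : Z.Finite) (hF0 : F ≠ 0) (hF : F.IsHomogeneous d)
    (hFZ : ∀ x ∈ Z, HasOrderAt m F x) (hdm : 2 * d < 5 * m) (hℓ : IsLine ℓ)
    (h6 : 6 ≤ {x ∈ Z | MemLine ℓ x}.ncard) (h3 : {x ∈ Z | ¬ MemLine ℓ x}.ncard = 3)
    (h2 : ∀ L, IsLine L → {x ∈ {x ∈ Z | ¬ MemLine ℓ x} | MemLine L x}.ncard ≤ 2) :
    {x ∈ Z | MemLine ℓ x}.ncard = 6 ∧ ∃ side D Q w, IsTriangleConfig Z ℓ side D Q w := by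
  have hAfin : {x ∈ Z | MemLine ℓ x}.Finite := hZ.subset (Set.sep_subset _ _)
  have hWfin : {x ∈ Z | ¬ MemLine ℓ x}.Finite := hZ.subset (Set.sep_subset _ _)
  have hfinset : ∀ {S : Set Plane}, S.ncard = 3 → ∃ w : Fin 3 → Plane, Function.Injective w ∧
      ∀ x, x ∈ S ↔ ∃ i, x = w i := by
    intro S hS
    obtain ⟨x, y, z, hxy, hxz, hyz, rfl⟩ := Set.ncard_eq_three.1 hS
    refine ⟨![x, y, z], ?_, fun t => ?_⟩
    · simp [Function.Injective, Fin.forall_fin_succ, hxy, hxz, hyz, hxy.symm, hxz.symm, hyz.symm]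
    · simp [Fin.exists_fin_succ]
  obtain ⟨w, hw, hwmem⟩ := hfinset h3
  have hwW : ∀ i, w i ∈ {x ∈ Z | ¬ MemLine ℓ x} := fun i => (hwmem _).2 ⟨i, rfl⟩
  have hw3 := noThreeCollinear_of_ncard_le_two hWfin h2 hw hwW
  choose side hside hside1 hside2 using fun k : Fin 3 => exists_line_through (w (k + 1)) (w (k + 2))
  have hsw : ∀ i k, i ≠ k → MemLine (side k) (w i) := by
    intro i k hik
    rcases (by revert i k; decide : i = k + 1 ∨ i = k + 2) with rfl | rfl
    exacts [hside1 k, hside2 k]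
  have hstep : ∀ (k : Fin 3) {S : Set Plane}, S ⊆ {x ∈ Z | MemLine ℓ x} →
      S.ncard ≤ (S \ {x | MemLine (side k) x}).ncard + 1 := fun k S hS =>
    hℓ.ncard_le_ncard_diff_add_one (hside k) (hside1 k) (hwW _).2 (hAfin.subset hS)
      fun x hx => (hS hx).2
  set A := {x ∈ Z | MemLine ℓ x} with hA
  set A₀ := A \ {x | MemLine (side 0) x} with hA₀
  set A₁ := A₀ \ {x | MemLine (side 1) x} with hA₁
  set T := A₁ \ {x | MemLine (side 2) x} with hT
  have hA₀A : A₀ ⊆ A := Set.sdiff_subset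
  have hA₁A₀ : A₁ ⊆ A₀ := Set.sdiff_subset
  have hTA₁ : T ⊆ A₁ := Set.sdiff_subset
  have e0 : A.ncard ≤ A₀.ncard + 1 := hstep 0 subset_rfl
  have e1 : A₀.ncard ≤ A₁.ncard + 1 := hstep 1 hA₀A
  have e2 : A₁.ncard ≤ T.ncard + 1 := hstep 2 (hA₁A₀.trans hA₀A)
  have hTside : ∀ x ∈ T, ∀ k, ¬ MemLine (side k) x := by
    rintro x ⟨⟨⟨-, h0⟩, h1⟩, h2⟩ k
    fin_cases k
    exacts [h0, h1, h2]
  have hT4 : T.ncard < 4 := by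
    by_contra! h4
    obtain ⟨q, hq, hqmem⟩ := Set.exists_injective_fin_of_le_ncard h4
    have hqA : ∀ i, q i ∈ A := fun i => hA₀A (hA₁A₀ (hTA₁ (hqmem i)))
    have := five_mul_le_of_triangle hℓ hq hw (fun i => (hqA i).2) (fun i => (hwW i).2) hw3
      (fun L hL i j hij hi hj k hk => by
        obtain ⟨s, hs⟩ := eq_side_of_two_vertices hside hw hsw hL hij hi hj
        exact hTside _ (hqmem k) s ((hs _).1 hk)) hF0 hF (fun i => hFZ _ (hqA i).1)
      (fun i => hFZ _ (hwW i).1)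
    omega
  obtain ⟨D, hD, hDmem⟩ := hfinset (S := T) (by omega)
  have hDT : ∀ i, D i ∈ T := fun i => (hDmem _).2 ⟨i, rfl⟩
  have hDA : ∀ i, D i ∈ A := fun i => hA₀A (hA₁A₀ (hTA₁ (hDT i)))
  have hexists : ∀ (k : Fin 3) {S : Set Plane}, S ⊆ A →
      (S \ {x | MemLine (side k) x}).ncard < S.ncard → ∃ x ∈ S, MemLine (side k) x := by
    intro k S hS hlt
    by_contra! h
    have hS' : S \ {x | MemLine (side k) x} = S := sdiff_eq_left.2 (Set.disjoint_left.2 h)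
    exact hlt.ne (by rw [hS'])
  obtain ⟨Q₀, hQ₀, hs₀⟩ := hexists 0 subset_rfl (by rw [← hA₀]; omega)
  obtain ⟨Q₁, hQ₁, hs₁⟩ := hexists 1 hA₀A (by rw [← hA₁]; omega)
  obtain ⟨Q₂, hQ₂, hs₂⟩ := hexists 2 (hA₁A₀.trans hA₀A) (by rw [← hT]; omega)
  have h01 : Q₀ ≠ Q₁ := MemLine.ne hs₀ hQ₁.2
  have h02 : Q₀ ≠ Q₂ := MemLine.ne hs₀ hQ₂.1.2
  have h12 : Q₁ ≠ Q₂ := MemLine.ne hs₁ hQ₂.2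
  have hQA : ∀ i, ![Q₀, Q₁, Q₂] i ∈ A := by
    simp [Fin.forall_fin_succ, hQ₀, hA₀A hQ₁, hA₀A (hA₁A₀ hQ₂)]
  have hQs : ∀ k, MemLine (side k) (![Q₀, Q₁, Q₂] k) := by
    simp [Fin.forall_fin_succ, hs₀, hs₁, hs₂]
  refine ⟨by omega, side, D, ![Q₀, Q₁, Q₂], w, hℓ, hside, hD, ?_, hw, fun i => (hDA i).1,
    fun i => (hQA i).1, fun i => (hwW i).1, fun x hx => ?_, fun i => (hDA i).2,
    fun i => (hQA i).2, fun i => (hwW i).2, hw3, hsw, hQs, fun k i => hTside _ (hDT i) k⟩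
  · simp [Function.Injective, Fin.forall_fin_succ, h01, h02, h12, h01.symm, h02.symm, h12.symm]
  · by_cases hxℓ : MemLine ℓ x
    · by_cases hxs : ∃ k, MemLine (side k) x
      · obtain ⟨k, hk⟩ := hxs
        exact Or.inr (Or.inl ⟨k, (hside k).eq_of_memLine hℓ (hside1 k) (hwW _).2 hk hxℓ (hQs k)
          (hQA k).2⟩)
      · push Not at hxs
        exact Or.inl ((hDmem x).1 ⟨⟨⟨⟨hx, hxℓ⟩, hxs 0⟩, hxs 1⟩, hxs 2⟩)
    · exact Or.inr (Or.inr ((hwmem x).1 ⟨hx, hxℓ⟩))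

/-- Either the points lie on a conic, or they form the exceptional configuration. -/
theorem containedInConic_or_exists_isTriangleConfig (hZ : Z.Finite) (hcard : 9 ≤ Z.ncard)
    (hF0 : F ≠ 0) (hF : F.IsHomogeneous d) (hFZ : ∀ x ∈ Z, HasOrderAt m F x)
    (hdm : 2 * d < 5 * m) :
    ContainedInConic Z ∨ Z.ncard = 9 ∧ ∃ ℓ, {x ∈ Z | MemLine ℓ x}.ncard = 6 ∧
      ∃ side D Q w, IsTriangleConfig Z ℓ side D Q w := by
  refine or_iff_not_imp_left.2 fun hconic => ?_
  by_cases h4 : ∃ ℓ, IsLine ℓ ∧ 4 ≤ {x ∈ Z | MemLine ℓ x}.ncard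
  swap
  · push Not at h4
    have := five_mul_le_of_forall_line_le_three hZ hcard hconic hF0 hF hFZ
      fun L hL => Nat.le_of_lt_succ (h4 L hL)
    omega
  obtain ⟨ℓ, hℓ, h4⟩ := h4
  have hsum : {x ∈ Z | MemLine ℓ x}.ncard + {x ∈ Z | ¬ MemLine ℓ x}.ncard = Z.ncard :=
    Set.ncard_inter_add_ncard_sdiff_eq_ncard Z {x | MemLine ℓ x} hZ
  have hWfin : {x ∈ Z | ¬ MemLine ℓ x}.Finite := hZ.subset (Set.sep_subset _ _)
  by_cases h3 : ∃ k, IsLine k ∧ 3 ≤ {x ∈ {x ∈ Z | ¬ MemLine ℓ x} | MemLine k x}.ncard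
  · obtain ⟨k, hk, h3⟩ := h3
    simp only [Set.mem_ofPred_eq, and_assoc] at h3
    have := five_mul_le_of_four_le_of_three_le hZ hcard hconic hF0 hF hFZ hℓ hk h4 h3
    omega
  push Not at h3
  have h2 : ∀ L, IsLine L → {x ∈ {x ∈ Z | ¬ MemLine ℓ x} | MemLine L x}.ncard ≤ 2 :=
    fun L hL => Nat.le_of_lt_succ (h3 L hL)
  have hW2 : 2 < {x ∈ Z | ¬ MemLine ℓ x}.ncard := by
    by_contra! hW
    have hline : ∃ M, IsLine M ∧ ∀ x ∈ {x ∈ Z | ¬ MemLine ℓ x}, MemLine M x := by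
      obtain ⟨P, Q, hPQ⟩ : ∃ P Q, {x ∈ Z | ¬ MemLine ℓ x} ⊆ {P, Q} := by
        rcases Nat.lt_or_ge 1 {x ∈ Z | ¬ MemLine ℓ x}.ncard with h | h
        · obtain ⟨P, Q, -, h⟩ := Set.ncard_eq_two.1 (le_antisymm hW h)
          exact ⟨P, Q, h.subset⟩
        · obtain ⟨P, hP⟩ := (Set.ncard_le_one_iff_subset_singleton hWfin).1 h
          exact ⟨P, P, by simpa using hP⟩
      obtain ⟨M, hM, hMP, hMQ⟩ := exists_line_through P Q
      refine ⟨M, hM, fun x hx => ?_⟩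
      rcases hPQ hx with rfl | rfl
      exacts [hMP, hMQ]
    obtain ⟨M, hM, hMx⟩ := hline
    exact hconic (containedInConic_of_mem_two_lines hℓ hM fun x hx =>
      or_iff_not_imp_left.2 fun h => hMx x ⟨hx, h⟩)
  have hW5 : {x ∈ Z | ¬ MemLine ℓ x}.ncard < 5 := by
    by_contra! h5
    obtain ⟨q, hq, hqmem⟩ := Set.exists_injective_fin_of_le_ncard h4
    obtain ⟨w, hw, hwmem⟩ := Set.exists_injective_fin_of_le_ncard h5
    have := five_mul_le_of_pentagon hℓ hq hw (fun i => (hqmem i).2) (fun i => (hwmem i).2)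
      (noThreeCollinear_of_ncard_le_two hWfin h2 hw hwmem) hF0 hF (fun i => hFZ _ (hqmem i).1)
      (fun i => hFZ _ (hwmem i).1)
    omega
  have hW4 : {x ∈ Z | ¬ MemLine ℓ x}.ncard ≠ 4 := by
    intro hW
    obtain ⟨q, hq, hqmem⟩ := Set.exists_injective_fin_of_le_ncard
      (S := {x ∈ Z | MemLine ℓ x}) (k := 5) (by omega)
    obtain ⟨w, hw, hwmem⟩ := Set.exists_injective_fin_of_le_ncard hW.ge
    have := five_mul_le_of_quadrangle hℓ hq hw (fun i => (hqmem i).2) (fun i => (hwmem i).2)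
      (noThreeCollinear_of_ncard_le_two hWfin h2 hw hwmem) hF0 hF (fun i => hFZ _ (hqmem i).1)
      (fun i => hFZ _ (hwmem i).1)
    omega
  obtain ⟨h6, H⟩ := exists_isTriangleConfig hZ hF0 hF hFZ hdm hℓ (by omega) (by omega) h2
  exact ⟨by omega, ℓ, h6, H⟩

end

section

variable {Z : Set Plane}

theorem MemLine.vanishesToOrder_one {C : MvPolynomial (Fin 3) ℂ} {P : Plane} (h : MemLine C P)
    {v : Fin 3 → ℂ} {hv : v ≠ 0} (hP : Projectivization.mk ℂ v hv = P) : VanishesToOrder 1 C v :=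
  vanishesToOrder_succ.2 ⟨h v hv hP, fun _ => vanishesToOrder_zero _ _⟩

theorem exists_mem_symbolicPower (hZ : Z.Finite) (m : ℕ) :
    ∃ F ∈ symbolicPower Z m, F ≠ 0 ∧ F.IsHomogeneous (initialDegree (symbolicPower Z m)) := by
  refine Nat.sInf_mem (s := {t | ∃ F ∈ symbolicPower Z m, F ≠ 0 ∧ F.IsHomogeneous t}) ?_
  choose L hL hLP _ using fun P : Plane => exists_line_through P P
  refine ⟨_, ∏ P ∈ hZ.toFinset, L P ^ m, fun P hP v hv hvP => ?_,
    Finset.prod_ne_zero_iff.2 fun P _ => pow_ne_zero m (hL P).1,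
    IsHomogeneous.prod _ _ (fun _ => 1 * m) fun P _ => (hL P).2.pow m⟩
  classical
  rw [← Finset.mul_prod_erase _ _ (hZ.mem_toFinset.2 hP)]
  simpa using (((hLP P).vanishesToOrder_one hvP).pow m).mul (vanishesToOrder_zero _ v)

theorem initialDegree_le {S : Set (MvPolynomial (Fin 3) ℂ)} {F : MvPolynomial (Fin 3) ℂ} {d : ℕ}
    (hFS : F ∈ S) (hF0 : F ≠ 0) (hF : F.IsHomogeneous d) : initialDegree S ≤ d :=
  Nat.sInf_le ⟨F, hFS, hF0, hF⟩

theorem waldschmidt_le_div (m : ℕ+) {F : MvPolynomial (Fin 3) ℂ} {d : ℕ}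
    (hFS : F ∈ symbolicPower Z m) (hF0 : F ≠ 0) (hF : F.IsHomogeneous d) :
    waldschmidt Z ≤ (d : ℝ) / (m : ℕ) := by
  have hbdd : BddBelow (Set.range fun m : ℕ+ =>
      (initialDegree (symbolicPower Z (m : ℕ)) : ℝ) / ((m : ℕ) : ℝ)) :=
    ⟨0, by rintro _ ⟨m, rfl⟩; positivity⟩
  refine (ciInf_le hbdd m).trans ?_
  gcongr
  exact initialDegree_le hFS hF0 hF

theorem ContainedInConic.waldschmidt_le_two (h : ContainedInConic Z) : waldschmidt Z ≤ 2 := by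
  obtain ⟨F, hF0, hF, hFZ⟩ := h
  simpa using waldschmidt_le_div 1
    (fun P hP v hv hvP => (hFZ P hP).vanishesToOrder_one hvP) hF0 hF

theorem div_le_waldschmidt (hZ : Z.Finite) {a b : ℕ} (hb : 0 < b)
    (H : ∀ (F : MvPolynomial (Fin 3) ℂ) (d m : ℕ), F ≠ 0 → F.IsHomogeneous d →
      (∀ x ∈ Z, HasOrderAt m F x) → a * m ≤ b * d) : (a : ℝ) / b ≤ waldschmidt Z := by
  refine le_ciInf fun m => ?_
  obtain ⟨F, hFS, hF0, hF⟩ := exists_mem_symbolicPower hZ (m : ℕ)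
  have h := H F _ m hF0 hF fun x hx => hasOrderAt_of_mem_symbolicPower hFS hx
  have hm : (0 : ℝ) < (m : ℕ) := by exact_mod_cast m.pos
  rw [div_le_div_iff₀ (by exact_mod_cast hb) hm]
  exact_mod_cast h.trans_eq (mul_comm _ _)

theorem exists_hasOrderAt_of_waldschmidt_lt (hZ : Z.Finite) (h : waldschmidt Z < 5 / 2) :
    ∃ (F : MvPolynomial (Fin 3) ℂ) (d m : ℕ), F ≠ 0 ∧ F.IsHomogeneous d ∧
      (∀ x ∈ Z, HasOrderAt m F x) ∧ 2 * d < 5 * m := by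
  by_contra! H
  refine absurd h (not_lt.2 ?_)
  exact_mod_cast div_le_waldschmidt (a := 5) (b := 2) hZ two_pos H

namespace IsTriangleConfig

variable {ℓ : MvPolynomial (Fin 3) ℂ} {side : Fin 3 → MvPolynomial (Fin 3) ℂ}
  {D Q w : Fin 3 → Plane}

theorem standardConfig (h : IsTriangleConfig Z ℓ side D Q w)
    (h6 : {x ∈ Z | MemLine ℓ x}.ncard = 6) : StandardConfig 6 Z := by
  refine ⟨ℓ, side 2, side 1, side 0, Q 2, Q 1, Q 0, w 0, w 1, w 2, h.isLine, h.isLine_side 2,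
    h.isLine_side 1, h.isLine_side 0, h.Q_mem 2, h.Q_mem 1, h.Q_mem 0, h.w_mem 0, h.w_mem 1,
    h.w_mem 2, h.injective_Q.ne (by decide), h.injective_Q.ne (by decide),
    h.injective_Q.ne (by decide), h.memLine_Q 2, h.memLine_Q 1, h.memLine_Q 0, h6, h.notMem_w 0,
    h.side_w 0 2 (by decide), h.side_Q 2, h.side_w 1 2 (by decide), h.injective_w.ne (by decide),
    ((h.memLine_Q 2).ne (h.notMem_w 1)).symm, h.notMem_w 1,
    h.side_w 0 1 (by decide), h.side_Q 1, h.side_w 2 1 (by decide), h.injective_w.ne (by decide),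
    ((h.memLine_Q 1).ne (h.notMem_w 2)).symm, h.notMem_w 2,
    h.side_w 1 0 (by decide), h.side_w 2 0 (by decide), h.side_Q 0, ?_⟩
  rintro X Y W hX hY hW hXY hXW hYW ⟨M, hM, hMX, hMY, hMW⟩
  have hvertex : ∀ x ∈ Z, ¬ MemLine ℓ x → ∃ i, x = w i := by
    intro x hx hxℓ
    rcases h.cover x hx with ⟨i, rfl⟩ | ⟨i, rfl⟩ | hi
    exacts [absurd (h.memLine_D i) hxℓ, absurd (h.memLine_Q i) hxℓ, hi]
  -- a line through two points of `Z`, either both on `ℓ` or both off `ℓ`, is `ℓ` or a side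
  have key : ∀ x ∈ Z, ∀ y ∈ Z, x ≠ y → MemLine M x → MemLine M y →
      (MemLine ℓ x ↔ MemLine ℓ y) →
      (∀ z, MemLine M z → MemLine ℓ z) ∨ ∃ k, ∀ z, MemLine M z → MemLine (side k) z := by
    intro x hx y hy hxy hMx hMy hiff
    by_cases hxℓ : MemLine ℓ x
    · exact Or.inl fun z => (hM.memLine_iff_of_two_points h.isLine hxy hMx hMy hxℓ
        (hiff.1 hxℓ) z).1
    · obtain ⟨i, rfl⟩ := hvertex x hx hxℓ
      obtain ⟨j, rfl⟩ := hvertex y hy (mt hiff.2 hxℓ)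
      obtain ⟨k, hk⟩ := eq_side_of_two_vertices h.isLine_side h.injective_w h.side_w hM
        (fun hij => hxy (congrArg w hij)) hMx hMy
      exact Or.inr ⟨k, fun z => (hk z).1⟩
  have hline : (∀ z, MemLine M z → MemLine ℓ z) ∨
      ∃ k, ∀ z, MemLine M z → MemLine (side k) z := by
    by_cases h1 : MemLine ℓ X ↔ MemLine ℓ Y
    · exact key X hX Y hY hXY hMX hMY h1
    by_cases h2 : MemLine ℓ X ↔ MemLine ℓ W
    · exact key X hX W hW hXW hMX hMW h2
    · exact key Y hY W hW hYW hMY hMW (by tauto)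
  rcases hline with hz | ⟨k, hz⟩
  · exact Or.inl ⟨hz X hMX, hz Y hMY, hz W hMW⟩
  · refine Or.inr ?_
    have := And.intro (hz X hMX) (And.intro (hz Y hMY) (hz W hMW))
    fin_cases k
    exacts [Or.inr (Or.inr this), Or.inr (Or.inl this), Or.inl this]

theorem seventeen_div_seven_le (h : IsTriangleConfig Z ℓ side D Q w) (hZ : Z.Finite) :
    17 / 7 ≤ waldschmidt Z := by
  have key := div_le_waldschmidt (a := 17) (b := 7) hZ (by norm_num) fun F d m hF0 hF hFZ =>
    seventeen_mul_le h.isLine h.injective_D h.injective_Q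
      (fun i j e => h.side_D j i (e ▸ h.side_Q j)) h.injective_w h.memLine_D h.memLine_Q
      h.notMem_w h.noThreeCollinear
      (fun L hL i j hij hi hj k hk => by
        obtain ⟨s, hs⟩ := eq_side_of_two_vertices h.isLine_side h.injective_w h.side_w hL hij hi hj
        exact h.side_D s k ((hs _).1 hk))
      (fun k => ⟨side k, h.isLine_side k, h.side_w _ _ (by revert k; decide),
        h.side_w _ _ (by revert k; decide), h.side_Q k⟩)
      hF0 hF (fun i => hFZ _ (h.D_mem i)) (fun i => hFZ _ (h.Q_mem i)) (fun i => hFZ _ (h.w_mem i))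
  exact_mod_cast key

/-- The quintuple line, the doubled sides and three conics, each through the vertices and two of
the points `D`, form a curve of degree `17` with points of multiplicity `7`. -/
theorem waldschmidt_le (h : IsTriangleConfig Z ℓ side D Q w) : waldschmidt Z ≤ 17 / 7 := by
  choose E hE0 hE hEp using fun k : Fin 3 =>
    exists_quadratic_through ![w 0, w 1, w 2, D (k + 1), D (k + 2)]
  have hEw : ∀ k i, MemLine (E k) (w i) := fun k i => by
    fin_cases i
    exacts [hEp k 0, hEp k 1, hEp k 2]
  have hED : ∀ i k, i ≠ k → MemLine (E k) (D i) := by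
    intro i k hik
    rcases (by revert i k; decide : i = k + 1 ∨ i = k + 2) with rfl | rfl
    exacts [hEp k 3, hEp k 4]
  have hmem : ∀ (v : Fin 3 → ℂ) (a : ℕ) (b c : Fin 3 → ℕ), VanishesToOrder a ℓ v →
      (∀ k, VanishesToOrder (b k) (side k) v) → (∀ k, VanishesToOrder (c k) (E k) v) →
      7 ≤ 5 * a + 2 * (b 0 + b 1 + b 2) + (c 0 + c 1 + c 2) →
      VanishesToOrder 7 (ℓ ^ 5 * (side 0 * side 1 * side 2) ^ 2 * (E 0 * E 1 * E 2)) v :=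
    fun v a b c ha hb hc h7 =>
      (((ha.pow 5).mul ((((hb 0).mul (hb 1)).mul (hb 2)).pow 2)).mul
        (((hc 0).mul (hc 1)).mul (hc 2))).mono h7
  have hindicator : ∀ {C : MvPolynomial (Fin 3) ℂ} {x : Plane} {p : Prop} [Decidable p]
      {v : Fin 3 → ℂ} {hv : v ≠ 0}, Projectivization.mk ℂ v hv = x → (p → MemLine C x) →
      VanishesToOrder (if p then 1 else 0) C v := by
    intro C x p _ v hv hx hC
    split_ifs with hp
    exacts [(hC hp).vanishesToOrder_one hx, vanishesToOrder_zero _ _]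
  have key := waldschmidt_le_div (Z := Z) 7
    (F := ℓ ^ 5 * (side 0 * side 1 * side 2) ^ 2 * (E 0 * E 1 * E 2)) (d := 17)
    (fun x hx v hv hvx => ?_)
    (mul_ne_zero (mul_ne_zero (pow_ne_zero _ h.isLine.1) (pow_ne_zero _
      (mul_ne_zero (mul_ne_zero (h.isLine_side 0).1 (h.isLine_side 1).1) (h.isLine_side 2).1)))
      (mul_ne_zero (mul_ne_zero (hE0 0) (hE0 1)) (hE0 2)))
    (((h.isLine.2.pow 5).mul
      ((((h.isLine_side 0).2.mul (h.isLine_side 1).2).mul (h.isLine_side 2).2).pow 2)).mul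
      (((hE 0).mul (hE 1)).mul (hE 2)))
  · simpa using key
  · rcases h.cover x hx with ⟨i, rfl⟩ | ⟨i, rfl⟩ | ⟨i, rfl⟩
    · refine hmem v 1 0 (fun k => if i ≠ k then 1 else 0)
        ((h.memLine_D i).vanishesToOrder_one hvx) (fun k => vanishesToOrder_zero _ _)
        (fun k => hindicator hvx (hED i k)) ?_
      clear hvx hx
      revert i
      decide
    · refine hmem v 1 (fun k => if i = k then 1 else 0) 0
        ((h.memLine_Q i).vanishesToOrder_one hvx)
        (fun k => hindicator hvx fun e => e ▸ h.side_Q i) (fun k => vanishesToOrder_zero _ _) ?_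
      clear hvx hx
      revert i
      decide
    · refine hmem v 0 (fun k => if i ≠ k then 1 else 0) 1 (vanishesToOrder_zero _ _)
        (fun k => hindicator hvx (h.side_w i k))
        (fun k => (hEw k i).vanishesToOrder_one hvx) ?_
      clear hvx hx
      revert i
      decide

end IsTriangleConfig

end

/-- Theorem A: if `Z` is a set of `s ≥ 9` points of `ℙ²` with Waldschmidt constant less than
`5/2`, then either `Z` is contained in a conic (and then `α̂(I) ≤ 2`), or `s = 9`, the points
form the configuration with a line containing exactly six of them (as in `StandardConfig 6`),
and `α̂(I) = 17/7`. -/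
theorem theoremA (Z : Set (ℙ ℂ (Fin 3 → ℂ)))
    (hfin : Z.Finite) (hcard : 9 ≤ Z.ncard) (h : waldschmidt Z < 5 / 2) :
    (ContainedInConic Z ∧ waldschmidt Z ≤ 2) ∨
      (Z.ncard = 9 ∧ StandardConfig 6 Z ∧ waldschmidt Z = 17 / 7) := by
  obtain ⟨F, d, m, hF0, hF, hFZ, hdm⟩ := exists_hasOrderAt_of_waldschmidt_lt hfin h
  rcases containedInConic_or_exists_isTriangleConfig hfin hcard hF0 hF hFZ hdm with
    hc | ⟨h9, ℓ, h6, side, D, Q, w, hw⟩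
  · exact Or.inl ⟨hc, hc.waldschmidt_le_two⟩
  · exact Or.inr ⟨h9, hw.standardConfig h6,
      le_antisymm hw.waldschmidt_le (hw.seventeen_div_seven_le hfin)⟩
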